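/- Every nonempty finite simple (C4, diamond, theta, pyramid, prism, even wheel)-free graph has a trisimplicial vertex, i.e., a vertex v such that N(v) is the union of three cliques. -/

import Mathlib

open SimpleGraph

namespace Paper

variable {V : Type*}

/-- `G` contains an induced subgraph isomorphic to `H`. -/
def ContainsInduced {W : Type*} (G : SimpleGraph V) (H : SimpleGraph W) : Prop :=
  ∃ S : Set V, Nonempty (G.induce S ≃g H)

/-- `G` is `H`-free: no induced subgraph of `G` is isomorphic to `H`. -/
def Free {W : Type*} (G : SimpleGraph V) (H : SimpleGraph W) : Prop :=
  ¬ ContainsInduced G H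

/-- The diamond: `K₄` minus an edge. -/
def diamond : SimpleGraph (Fin 4) :=
  (⊤ : SimpleGraph (Fin 4)).deleteEdges {s(0, 1)}

/-- `S` induces a hole (an induced cycle of length at least 4) in `G`. -/
def IsHoleSet (G : SimpleGraph V) (S : Set V) : Prop :=
  ∃ n : ℕ, 4 ≤ n ∧ Nonempty (G.induce S ≃g cycleGraph n)

/-- `G` contains an even hole. -/
def HasEvenHole (G : SimpleGraph V) : Prop :=
  ∃ S : Set V, ∃ n : ℕ, 4 ≤ n ∧ Even n ∧ Nonempty (G.induce S ≃g cycleGraph n)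

/-- The union of the vertex sets of two walks induces a hole in `G`. -/
def PairHole (G : SimpleGraph V) {a b c d : V} (P : G.Walk a b) (Q : G.Walk c d) : Prop :=
  IsHoleSet G {v | v ∈ P.support ∨ v ∈ Q.support}

/-- `G` contains a theta. -/
def HasTheta (G : SimpleGraph V) : Prop :=
  ∃ (a b : V) (P₁ P₂ P₃ : G.Walk a b),
    a ≠ b ∧ ¬ G.Adj a b ∧
    P₁.IsPath ∧ P₂.IsPath ∧ P₃.IsPath ∧
    PairHole G P₁ P₂ ∧ PairHole G P₁ P₃ ∧ PairHole G P₂ P₃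

/-- `G` contains a pyramid. -/
def HasPyramid (G : SimpleGraph V) : Prop :=
  ∃ (a b₁ b₂ b₃ : V) (P₁ : G.Walk a b₁) (P₂ : G.Walk a b₂) (P₃ : G.Walk a b₃),
    G.Adj b₁ b₂ ∧ G.Adj b₁ b₃ ∧ G.Adj b₂ b₃ ∧
    a ≠ b₁ ∧ a ≠ b₂ ∧ a ≠ b₃ ∧
    P₁.IsPath ∧ P₂.IsPath ∧ P₃.IsPath ∧
    PairHole G P₁ P₂ ∧ PairHole G P₁ P₃ ∧ PairHole G P₂ P₃

/-- `G` contains a prism. -/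
def HasPrism (G : SimpleGraph V) : Prop :=
  ∃ (a₁ a₂ a₃ b₁ b₂ b₃ : V) (P₁ : G.Walk a₁ b₁) (P₂ : G.Walk a₂ b₂) (P₃ : G.Walk a₃ b₃),
    G.Adj a₁ a₂ ∧ G.Adj a₁ a₃ ∧ G.Adj a₂ a₃ ∧
    G.Adj b₁ b₂ ∧ G.Adj b₁ b₃ ∧ G.Adj b₂ b₃ ∧
    ({a₁, a₂, a₃} : Set V) ∩ {b₁, b₂, b₃} = ∅ ∧
    P₁.IsPath ∧ P₂.IsPath ∧ P₃.IsPath ∧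
    PairHole G P₁ P₂ ∧ PairHole G P₁ P₃ ∧ PairHole G P₂ P₃

/-- The neighbors of `v` inside the set `S`. -/
def nbrsIn (G : SimpleGraph V) (S : Set V) (v : V) : Set V :=
  {u | u ∈ S ∧ G.Adj v u}

/-- `(S, v)` is a wheel of `G`: `S` is a hole and `v ∉ S` has at least 3 neighbors in `S`. -/
def IsWheel (G : SimpleGraph V) (S : Set V) (v : V) : Prop :=
  IsHoleSet G S ∧ v ∉ S ∧ 3 ≤ (nbrsIn G S v).ncard

/-- `(S, v)` is an even wheel of `G`. -/
def IsEvenWheel (G : SimpleGraph V) (S : Set V) (v : V) : Prop :=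
  IsWheel G S v ∧ Even (nbrsIn G S v).ncard

def HasWheel (G : SimpleGraph V) : Prop := ∃ (S : Set V) (v : V), IsWheel G S v

def HasEvenWheel (G : SimpleGraph V) : Prop := ∃ (S : Set V) (v : V), IsEvenWheel G S v

/-- A bug: a wheel whose hub has exactly three neighbors in the hole,
exactly two of which are adjacent. -/
def IsBug (G : SimpleGraph V) (S : Set V) (v : V) : Prop :=
  IsWheel G S v ∧ ∃ x y z : V, x ≠ y ∧ x ≠ z ∧ y ≠ z ∧
    nbrsIn G S v = {x, y, z} ∧ G.Adj x y ∧ ¬ G.Adj x z ∧ ¬ G.Adj y z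

/-- A twin wheel: the neighbors of the hub in the hole induce a path of length two. -/
def IsTwinWheel (G : SimpleGraph V) (S : Set V) (v : V) : Prop :=
  IsWheel G S v ∧ ∃ x y z : V, x ≠ y ∧ x ≠ z ∧ y ≠ z ∧
    nbrsIn G S v = {x, y, z} ∧ G.Adj x y ∧ G.Adj y z ∧ ¬ G.Adj x z

/-- A universal wheel: the hub is adjacent to every vertex of the hole. -/
def IsUniversalWheel (G : SimpleGraph V) (S : Set V) (v : V) : Prop :=
  IsWheel G S v ∧ ∀ u ∈ S, G.Adj v u

/-- `G` is a member of the class 𝒞 of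
(C4, diamond, theta, pyramid, prism, even wheel)-free graphs. -/
def InC (G : SimpleGraph V) : Prop :=
  Free G (cycleGraph 4) ∧ Free G diamond ∧ ¬ HasTheta G ∧ ¬ HasPyramid G ∧
    ¬ HasPrism G ∧ ¬ HasEvenWheel G

/-- The independence number of `G`. -/
noncomputable def indepNum (G : SimpleGraph V) : ℕ :=
  sSup {n | ∃ S : Set V, (S.Pairwise fun u v => ¬ G.Adj u v) ∧ S.ncard = n}

/-- The clique number of `G`. -/
noncomputable def cliqueNum (G : SimpleGraph V) : ℕ :=
  sSup {n | ∃ S : Set V, G.IsClique S ∧ S.ncard = n}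

/-- The (vertex) clique cover number of `G`: the minimum number of parts in a
partition of the vertex set of `G` into cliques. -/
noncomputable def cliqueCoverNum (G : SimpleGraph V) : ℕ :=
  sInf {n | ∃ F : Finset (Set V), F.card = n ∧ (∀ C ∈ F, G.IsClique C) ∧
    ∀ v : V, ∃! C : Set V, C ∈ F ∧ v ∈ C}

/-- A tree decomposition of `G`. -/
structure TreeDecomp (G : SimpleGraph V) where
  ι : Type
  tree : SimpleGraph ι
  tree_acyclic : tree.IsAcyclic
  tree_connected : tree.Connected
  bag : ι → Set V
  bag_cover : ∀ v : V, ∃ t, v ∈ bag t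
  bag_edge : ∀ ⦃u v : V⦄, G.Adj u v → ∃ t, u ∈ bag t ∧ v ∈ bag t
  bag_subtree : ∀ v : V, (tree.induce {t | v ∈ bag t}).Connected

/-- The treewidth of `G`: the minimum over tree decompositions of (max bag size − 1). -/
noncomputable def treewidth (G : SimpleGraph V) : ℕ :=
  sInf {k | ∃ D : TreeDecomp G, ∀ t, (D.bag t).ncard ≤ k + 1}

/-- The tree independence number of `G`. -/
noncomputable def treeIndepNum (G : SimpleGraph V) : ℕ :=
  sInf {k | ∃ D : TreeDecomp G, ∀ t, indepNum (G.induce (D.bag t)) ≤ k}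

/-- The tree clique cover number of `G`. -/
noncomputable def treeCliqueCoverNum (G : SimpleGraph V) : ℕ :=
  sInf {k | ∃ D : TreeDecomp G, ∀ t, cliqueCoverNum (G.induce (D.bag t)) ≤ k}

/-- A weight function on a finite graph: values in `[0,1]` summing to `1`. -/
def IsWeightFn [Fintype V] (w : V → ℝ) : Prop :=
  (∀ v, 0 ≤ w v ∧ w v ≤ 1) ∧ ∑ v, w v = 1

/-- The weight of a set of vertices. -/
noncomputable def wSet (w : V → ℝ) (S : Set V) : ℝ := ∑ᶠ x ∈ S, w x

/-- `X` is a `(w, c)`-balanced separator of `G`: every connected component of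
`G − X` has weight at most `c`. -/
def IsBalancedSep (G : SimpleGraph V) (w : V → ℝ) (c : ℝ) (X : Set V) : Prop :=
  ∀ D : (G.induce Xᶜ).ConnectedComponent, wSet w (Subtype.val '' D.supp) ≤ c

/-- `G` has a clique cutset: a clique `C` such that `G − C` is disconnected. -/
def HasCliqueCutset (G : SimpleGraph V) : Prop :=
  ∃ C : Set V, G.IsClique C ∧ ¬ (G.induce Cᶜ).Preconnected

/-- The closed neighborhood of `v`. -/
def closedNbhd (G : SimpleGraph V) (v : V) : Set V := insert v (G.neighborSet v)

/-- The (open) neighborhood of a set `S`: vertices outside `S` with a neighbor in `S`. -/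
def setNbhd (G : SimpleGraph V) (S : Set V) : Set V :=
  {v | v ∉ S ∧ ∃ u ∈ S, G.Adj v u}

/-- `(A, C, B)` is a separation of `G`. -/
def IsSeparation (G : SimpleGraph V) (A C B : Set V) : Prop :=
  A ∪ C ∪ B = Set.univ ∧ Disjoint A C ∧ Disjoint A B ∧ Disjoint C B ∧
    ∀ a ∈ A, ∀ b ∈ B, ¬ G.Adj a b

/-- `v` is a balanced vertex with respect to `w`: every connected component of
`G − N[v]` has weight at most `1/2`. -/
def IsBalancedVtx (G : SimpleGraph V) (w : V → ℝ) (v : V) : Prop :=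
  ∀ D : (G.induce (closedNbhd G v)ᶜ).ConnectedComponent,
    wSet w (Subtype.val '' D.supp) ≤ 1 / 2


/-! ### Induced paths, recorded by their end vertices and vertex set -/

/-- `IP G a b S`: the set `S` induces a path of `G` with ends `a` and `b`. -/
inductive IP (G : SimpleGraph V) : V → V → Set V → Prop
  | single (a : V) : IP G a a {a}
  | cons {a b c : V} {S : Set V} (hab : G.Adj a b) (h : IP G b c S) (ha : a ∉ S)
      (hs : ∀ s ∈ S, G.Adj a s → s = b) : IP G a c (insert a S)

section IPbasics
variable {G : SimpleGraph V}

lemma IP.left_mem {a b : V} {S : Set V} (h : IP G a b S) : a ∈ S := by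
  cases h <;> simp

lemma IP.right_mem {a b : V} {S : Set V} (h : IP G a b S) : b ∈ S := by
  induction h with
  | single a => simp
  | cons _ _ _ _ ih => exact Or.inr ih

lemma IP.congr {a b : V} {S T : Set V} (h : IP G a b S) (e : S = T) : IP G a b T := e ▸ h

lemma IP.append {a b c d : V} {S T : Set V} (h : IP G a b S) (h' : IP G c d T)
    (hbc : G.Adj b c) (hd : ∀ s ∈ S, s ∉ T)
    (he : ∀ s ∈ S, ∀ t ∈ T, G.Adj s t → s = b ∧ t = c) : IP G a d (S ∪ T) := by
  induction h with
  | single a =>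
    refine (IP.cons hbc h' (hd a rfl) ?_).congr (by ext; simp)
    intro s hs h1
    exact (he a rfl s hs h1).2
  | @cons a e b S hab h ha hs ih =>
    have ih' := ih hbc (fun s hs => hd s (Or.inr hs)) (fun s hs => he s (Or.inr hs))
    refine (IP.cons hab ih' ?_ ?_).congr (by rw [Set.insert_union])
    · rintro (h1 | h1)
      · exact ha h1
      · exact hd a (Or.inl rfl) h1
    · rintro s (h1 | h1) h2
      · exact hs s h1 h2
      · have := (he a (Or.inl rfl) s h1 h2).1
        subst this
        exact absurd h.right_mem ha

lemma IP.symm {a b : V} {S : Set V} (h : IP G a b S) : IP G b a S := by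
  induction h with
  | single a => exact IP.single a
  | @cons a e b S hab h ha hs ih =>
    refine (ih.append (IP.single a) hab.symm ?_ ?_).congr (by ext; simp)
    · rintro s h1 rfl
      exact ha h1
    · rintro s h1 t rfl h2
      exact ⟨hs s h1 h2.symm, rfl⟩

lemma IP.eq_single {a : V} {S : Set V} (h : IP G a a S) : S = {a} := by
  cases h with
  | single => rfl
  | cons hab h ha hs => exact absurd h.right_mem ha

/-- Remove the first vertex. -/
lemma IP.tail {a b : V} {S : Set V} (h : IP G a b S) (hab : a ≠ b) :
    ∃ c, IP G c b (S \ {a}) ∧ G.Adj a c ∧ ∀ s ∈ S, G.Adj a s → s = c := by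
  cases h with
  | single => exact absurd rfl hab
  | @cons _ c _ S hab h ha hs =>
    refine ⟨c, h.congr ?_, hab, ?_⟩
    · ext x
      simp only [Set.mem_sdiff, Set.mem_insert_iff, Set.mem_singleton_iff]
      grind
    · rintro s (rfl | h1) h2
      · exact absurd h2 (G.loopless.irrefl _)
      · exact hs s h1 h2

/-- Split a path at its first vertex with property `P`. -/
lemma IP.first {a b : V} {S : Set V} (h : IP G a b S) (P : V → Prop) (hP : ∃ s ∈ S, P s) :
    ∃ z S₁ S₂, S = S₁ ∪ S₂ ∧ (∀ s ∈ S₁, s ∉ S₂) ∧ IP G a z S₁ ∧ P z ∧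
      (∀ s ∈ S₁, P s → s = z) ∧
      ((S₂ = ∅ ∧ z = b) ∨ (b ∉ S₁ ∧ ∃ z', IP G z' b S₂ ∧ G.Adj z z' ∧
        ∀ s ∈ S₁, ∀ t ∈ S₂, G.Adj s t → s = z ∧ t = z')) := by
  induction h with
  | single a =>
    obtain ⟨s, rfl, hs⟩ := hP
    exact ⟨s, {s}, ∅, by simp, by simp, IP.single s, hs, by simp, Or.inl ⟨rfl, rfl⟩⟩
  | @cons a e b S hab h ha hs ih =>
    by_cases hPa : P a
    · refine ⟨a, {a}, S, by ext; simp, by simpa using ha, IP.single a, hPa, by simp, Or.inr ⟨?_, e, h, hab, ?_⟩⟩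
      · rintro rfl
        exact ha h.right_mem
      · rintro s rfl t ht h1
        exact ⟨rfl, hs t ht h1⟩
    · obtain ⟨z, S₁, S₂, hS, hd, hz, hPz, hu, hr⟩ := ih (by
        obtain ⟨s, (rfl | h1), h2⟩ := hP
        · exact absurd h2 hPa
        · exact ⟨s, h1, h2⟩)
      subst hS
      have haS1 : a ∉ S₁ := fun h => ha (Or.inl h)
      have haS2 : a ∉ S₂ := fun h => ha (Or.inr h)
      refine ⟨z, insert a S₁, S₂, by rw [Set.insert_union], ?_, IP.cons hab hz haS1 (fun s h1 => hs s (Or.inl h1)), hPz, ?_, ?_⟩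
      · rintro s (rfl | h1)
        · exact haS2
        · exact hd s h1
      · rintro s (rfl | h1) h2
        · exact absurd h2 hPa
        · exact hu s h1 h2
      · rcases hr with hr | ⟨hb, z', hz', hzz, he⟩
        · exact Or.inl hr
        · refine Or.inr ⟨?_, z', hz', hzz, ?_⟩
          · rintro (rfl | h1)
            · exact ha h.right_mem
            · exact hb h1
          · rintro s (rfl | h1) t ht h2
            · have := hs t (Or.inr ht) h2
              subst this
              exact absurd ht (hd t hz.left_mem)
            · exact he s h1 t ht h2

lemma IP.walk {a b : V} {S : Set V} (h : IP G a b S) :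
    ∃ w : G.Walk a b, w.IsPath ∧ ∀ v, v ∈ w.support ↔ v ∈ S := by
  induction h with
  | single a => exact ⟨Walk.nil, by simp, by simp⟩
  | @cons a e b S hab h ha hs ih =>
    obtain ⟨w, hw, hw'⟩ := ih
    refine ⟨Walk.cons hab w, ?_, ?_⟩
    · rw [Walk.cons_isPath_iff]
      exact ⟨hw, fun h1 => ha ((hw' a).1 h1)⟩
    · intro v
      simp [hw']

lemma IP.fn {a b : V} {S : Set V} (h : IP G a b S) :
    ∃ (n : ℕ) (f : ℕ → V), f 0 = a ∧ f n = b ∧ (∀ v, v ∈ S ↔ ∃ i ≤ n, f i = v) ∧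
      ∀ i ≤ n, ∀ j ≤ n, (f i = f j → i = j) ∧ (G.Adj (f i) (f j) ↔ i + 1 = j ∨ j + 1 = i) := by
  induction h with
  | single a =>
    refine ⟨0, fun _ => a, rfl, rfl, by simp [eq_comm], ?_⟩
    intro i hi j hj
    have : i = 0 := by omega
    have : j = 0 := by omega
    subst_vars
    simp
  | @cons a e b S hab h ha hs ih =>
    obtain ⟨n, f, h0, hn, hS, hf⟩ := ih
    refine ⟨n + 1, fun i => if i = 0 then a else f (i - 1), by simp, by simpa using hn, ?_, ?_⟩
    · intro v
      rw [Set.mem_insert_iff, hS]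
      constructor
      · rintro (rfl | ⟨i, hi, rfl⟩)
        · exact ⟨0, by omega, by simp⟩
        · exact ⟨i + 1, by omega, by simp⟩
      · rintro ⟨i, hi, rfl⟩
        by_cases h : i = 0
        · simp [h]
        · exact Or.inr ⟨i - 1, by omega, by simp [h]⟩
    · have key : ∀ j ≤ n, a ≠ f j ∧ (G.Adj a (f j) ↔ j = 0) := by
        intro j hj
        have hm : f j ∈ S := (hS _).2 ⟨j, hj, rfl⟩
        refine ⟨fun h1 => ha (h1 ▸ hm), ?_, ?_⟩
        · intro h1
          have := hs _ hm h1
          exact (hf j hj 0 (by omega)).1 (by rw [this, h0])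
        · rintro rfl
          rw [h0]; exact hab
      intro i hi j hj
      rcases i with _ | i <;> rcases j with _ | j
      · simp
      · have := key j (by omega)
        simp [this]
      · have := key i (by omega)
        simp [this.1.symm, G.adj_comm _ a, this.2]
      · have := hf i (by omega) j (by omega)
        simp only [Nat.add_eq_zero_iff, one_ne_zero, and_false, if_false, Nat.add_sub_cancel]
        refine ⟨fun h1 => by rw [this.1 h1], ?_⟩
        rw [this.2]; omega

/-- `C` is a hole, cut open at its vertex `c`. -/
def HoleAt (G : SimpleGraph V) (c : V) (C : Set V) : Prop :=
  c ∈ C ∧ ∃ p q, IP G p q (C \ {c}) ∧ p ≠ q ∧ ¬ G.Adj p q ∧ G.Adj c p ∧ G.Adj c q ∧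
    ∀ s ∈ C, G.Adj c s → s = p ∨ s = q

lemma HoleAt.isHoleSet {c : V} {C : Set V} (h : HoleAt G c C) : IsHoleSet G C := by
  obtain ⟨hc, p, q, hP, hpq, hnpq, hcp, hcq, hu⟩ := h
  obtain ⟨n, f, h0, hn, hS, hf⟩ := hP.fn
  have hn2 : 2 ≤ n := by
    by_contra hlt
    have : n = 0 ∨ n = 1 := by omega
    rcases this with rfl | rfl
    · exact hpq (h0 ▸ hn)
    · apply hnpq
      rw [← h0, ← hn, (hf 0 (by omega) 1 (by omega)).2]
      simp
  refine ⟨n + 2, by omega, ⟨?_⟩⟩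
  have hfc : ∀ i ≤ n, f i ≠ c ∧ f i ∈ C ∧ (G.Adj c (f i) ↔ i = 0 ∨ i = n) := by
    intro i hi
    have hm : f i ∈ C \ {c} := (hS _).2 ⟨i, hi, rfl⟩
    refine ⟨hm.2, hm.1, ?_, ?_⟩
    · intro h1
      rcases hu _ hm.1 h1 with h2 | h2
      · left; exact (hf i hi 0 (by omega)).1 (by rw [h2, h0])
      · right; exact (hf i hi n le_rfl).1 (by rw [h2, hn])
    · rintro (rfl | rfl)
      · rwa [h0]
      · rwa [hn]
  let g : Fin (n + 2) → C := fun i => if h : (i : ℕ) ≤ n then ⟨f i, (hfc i h).2.1⟩ else ⟨c, hc⟩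
  have gv : ∀ i : Fin (n + 2), (i : ℕ) ≤ n → (g i : V) = f i := by
    intro i hi; simp [g, hi]
  have gc : ∀ i : Fin (n + 2), ¬ (i : ℕ) ≤ n → (g i : V) = c := by
    intro i hi; simp [g, hi]
  have ginj : Function.Injective g := by
    intro i j hij
    have hij' : (g i : V) = g j := by rw [hij]
    apply Fin.ext
    by_cases hi : (i : ℕ) ≤ n <;> by_cases hj : (j : ℕ) ≤ n
    · rw [gv i hi, gv j hj] at hij'
      exact (hf i hi j hj).1 hij'
    · rw [gv i hi, gc j hj] at hij'
      exact absurd hij' (hfc i hi).1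
    · rw [gc i hi, gv j hj] at hij'
      exact absurd hij'.symm (hfc j hj).1
    · omega
  have gsurj : Function.Surjective g := by
    rintro ⟨v, hv⟩
    by_cases hvc : v = c
    · subst hvc
      refine ⟨⟨n + 1, by omega⟩, Subtype.ext ?_⟩
      exact gc _ (by simp)
    · obtain ⟨i, hi, rfl⟩ := (hS v).1 ⟨hv, hvc⟩
      refine ⟨⟨i, by omega⟩, Subtype.ext ?_⟩
      exact gv _ hi
  have gadj : ∀ i j, (G.induce C).Adj (g i) (g j) ↔ (cycleGraph (n + 2)).Adj i j := by
    intro i j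
    rw [comap_adj, cycleGraph_adj']
    have e1 : ((i - j : Fin (n+2)) : ℕ) = 1 ↔ (j : ℕ) + 1 = i ∨ ((i : ℕ) = 0 ∧ (j : ℕ) = n + 1) := by
      have hi := i.2
      have hj := j.2
      rw [Fin.sub_def]
      simp only
      rcases Nat.lt_or_ge (n + 2 - j + i) (n + 2) with h | h
      · rw [Nat.mod_eq_of_lt h]; omega
      · rw [Nat.mod_eq_sub_mod h, Nat.mod_eq_of_lt (by omega)]; omega
    have e2 : ((j - i : Fin (n+2)) : ℕ) = 1 ↔ (i : ℕ) + 1 = j ∨ ((j : ℕ) = 0 ∧ (i : ℕ) = n + 1) := by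
      have hi := i.2
      have hj := j.2
      rw [Fin.sub_def]
      simp only
      rcases Nat.lt_or_ge (n + 2 - i + j) (n + 2) with h | h
      · rw [Nat.mod_eq_of_lt h]; omega
      · rw [Nat.mod_eq_sub_mod h, Nat.mod_eq_of_lt (by omega)]; omega
    rw [e1, e2]
    have hi2 := i.2
    have hj2 := j.2
    simp only [Function.Embedding.subtype_apply]
    by_cases hi : (i : ℕ) ≤ n <;> by_cases hj : (j : ℕ) ≤ n
    · rw [gv i hi, gv j hj, (hf i hi j hj).2]; omega
    · rw [gv i hi, gc j hj, G.adj_comm, (hfc i hi).2.2]; omega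
    · rw [gc i hi, gv j hj, (hfc j hj).2.2]; omega
    · rw [gc i hi, gc j hj]
      simp only [SimpleGraph.irrefl, false_iff]; omega
  exact (⟨Equiv.ofBijective g ⟨ginj, gsurj⟩, fun {i j} => gadj i j⟩ : cycleGraph (n+2) ≃g G.induce C).symm

/-- Two disjoint paths whose ends are joined form a hole. -/
lemma HoleAt.of_two {a b a' b' : V} {A B : Set V} (hA : IP G a b A) (hB : IP G a' b' B)
    (hd : ∀ s ∈ A, s ∉ B) (haa : G.Adj a a') (hbb : G.Adj b b') (hab : a ≠ b)
    (hne : ¬ G.Adj a b ∨ a' ≠ b')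
    (he : ∀ s ∈ A, ∀ t ∈ B, G.Adj s t → (s = a ∧ t = a') ∨ (s = b ∧ t = b')) :
    HoleAt G a (A ∪ B) := by
  refine ⟨Or.inl hA.left_mem, ?_⟩
  obtain ⟨p, hp, hap, hpu⟩ := hA.tail hab
  have haB := hd a hA.left_mem
  refine ⟨p, a', (hp.append hB.symm hbb ?_ ?_).congr ?_, ?_, ?_, hap, haa, ?_⟩
  · intro s hs; exact hd s hs.1
  · rintro s ⟨hs, hsa⟩ t ht h1
    rcases he s hs t ht h1 with h2 | h2
    · exact absurd h2.1 hsa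
    · exact h2
  · ext x
    simp only [Set.mem_union, Set.mem_sdiff, Set.mem_singleton_iff]
    grind
  · rintro rfl
    exact hd _ hp.left_mem.1 hB.left_mem
  · intro h1
    rcases he p hp.left_mem.1 a' hB.left_mem h1 with ⟨rfl, _⟩ | ⟨rfl, h2⟩
    · exact hp.left_mem.2 rfl
    · rcases hne with hne | hne
      · exact hne hap
      · exact hne h2
  · rintro s (hs | hs) h1
    · exact Or.inl (hpu s hs h1)
    · rcases he a hA.left_mem s hs h1 with h2 | h2
      · exact Or.inr h2.2
      · exact absurd h2.1 hab

end IPbasics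

/-! ### Consequences of the forbidden configurations -/

section Forbidden
variable {G : SimpleGraph V}

/-- `S` is the interior of a path from `c` to `z`. -/
structure Leg (G : SimpleGraph V) (c z a b : V) (S : Set V) : Prop where
  ip : IP G a b S
  hc : c ∉ S
  hz : z ∉ S
  ca : G.Adj c a
  zb : G.Adj z b
  cu : ∀ s ∈ S, G.Adj c s → s = a
  zu : ∀ s ∈ S, G.Adj z s → s = b

/-- Disjoint sets with no edges between them. -/
def Anti (G : SimpleGraph V) (S T : Set V) : Prop := ∀ s ∈ S, ∀ t ∈ T, s ≠ t ∧ ¬ G.Adj s t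

lemma Leg.full {c z a b : V} {S : Set V} (h : Leg G c z a b S) (hcz : c ≠ z)
    (hn : ¬ G.Adj c z) : IP G c z (insert c (S ∪ {z})) := by
  have h1 : IP G a z (S ∪ {z}) := h.ip.append (IP.single z) h.zb.symm
    (fun s hs hsz => h.hz (by rw [Set.mem_singleton_iff] at hsz; rwa [← hsz]))
    (by
      rintro s hs t rfl h1
      exact ⟨h.zu s hs h1.symm, rfl⟩)
  refine IP.cons h.ca h1 ?_ ?_
  · rintro (h2 | h2)
    · exact h.hc h2
    · exact hcz h2
  · rintro s (h2 | rfl) h3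
    · exact h.cu s h2 h3
    · exact absurd h3 hn

lemma Leg.pair {c z a b a' b' : V} {S S' : Set V} (h : Leg G c z a b S) (h' : Leg G c z a' b' S')
    (hcz : c ≠ z) (hn : ¬ G.Adj c z) (hA : Anti G S S') :
    IsHoleSet G (insert c (S ∪ {z}) ∪ S') := by
  refine HoleAt.isHoleSet (c := c) (HoleAt.of_two (h.full hcz hn) h'.ip ?_ h'.ca h'.zb hcz (Or.inl hn) ?_)
  · rintro s (rfl | h1 | rfl) h2
    · exact h'.hc h2
    · exact (hA s h1 s h2).1 rfl
    · exact h'.hz h2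
  · rintro s (rfl | h1 | rfl) t ht h2
    · exact Or.inl ⟨rfl, h'.cu t ht h2⟩
    · exact absurd h2 (hA s h1 t ht).2
    · exact Or.inr ⟨rfl, h'.zu t ht h2⟩

lemma no_theta (hG : InC G) {c z a₁ b₁ a₂ b₂ a₃ b₃ : V} {S₁ S₂ S₃ : Set V} (hcz : c ≠ z)
    (hn : ¬ G.Adj c z) (h₁ : Leg G c z a₁ b₁ S₁) (h₂ : Leg G c z a₂ b₂ S₂)
    (h₃ : Leg G c z a₃ b₃ S₃) (h12 : Anti G S₁ S₂) (h13 : Anti G S₁ S₃) (h23 : Anti G S₂ S₃) :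
    False := by
  obtain ⟨w₁, p₁, s₁⟩ := (h₁.full hcz hn).walk
  obtain ⟨w₂, p₂, s₂⟩ := (h₂.full hcz hn).walk
  obtain ⟨w₃, p₃, s₃⟩ := (h₃.full hcz hn).walk
  refine hG.2.2.1 ⟨c, z, w₁, w₂, w₃, hcz, hn, p₁, p₂, p₃, ?_, ?_, ?_⟩
  · have := h₁.pair h₂ hcz hn h12
    unfold PairHole
    convert this using 1
    ext v
    simp only [s₁, s₂, Set.mem_setOf_eq, Set.mem_union, Set.mem_insert_iff, Set.mem_singleton_iff]
    tauto
  · have := h₁.pair h₃ hcz hn h13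
    unfold PairHole
    convert this using 1
    ext v
    simp only [s₁, s₃, Set.mem_setOf_eq, Set.mem_union, Set.mem_insert_iff, Set.mem_singleton_iff]
    tauto
  · have := h₂.pair h₃ hcz hn h23
    unfold PairHole
    convert this using 1
    ext v
    simp only [s₂, s₃, Set.mem_setOf_eq, Set.mem_union, Set.mem_insert_iff, Set.mem_singleton_iff]
    tauto

/-- `S` is a path from a neighbor `a` of the apex `c` to `b`. -/
structure PLeg (G : SimpleGraph V) (c a b : V) (S : Set V) : Prop where
  ip : IP G a b S
  hc : c ∉ S
  ca : G.Adj c a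
  cu : ∀ s ∈ S, G.Adj c s → s = a

lemma PLeg.full {c a b : V} {S : Set V} (h : PLeg G c a b S) : IP G c b (insert c S) :=
  IP.cons h.ca h.ip h.hc h.cu

/-- The only edge between `S` and `S'` is `bb'`. -/
def OneEdge (G : SimpleGraph V) (b b' : V) (S S' : Set V) : Prop :=
  ∀ s ∈ S, ∀ t ∈ S', s ≠ t ∧ (G.Adj s t → s = b ∧ t = b')

lemma PLeg.pair {c a b a' b' : V} {S S' : Set V} (h : PLeg G c a b S) (h' : PLeg G c a' b' S')
    (hb : G.Adj b b') (hne : ¬ (a = b ∧ a' = b')) (hA : OneEdge G b b' S S') :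
    IsHoleSet G (insert c S ∪ S') := by
  refine HoleAt.isHoleSet (c := c) (HoleAt.of_two h.full h'.ip ?_ h'.ca hb ?_ ?_ ?_)
  · rintro s (rfl | h1) h2
    · exact h'.hc h2
    · exact (hA s h1 s h2).1 rfl
  · rintro rfl
    exact h.hc h.ip.right_mem
  · by_contra hcon
    push Not at hcon
    exact hne ⟨(h.cu b h.ip.right_mem hcon.1).symm, hcon.2⟩
  · rintro s (rfl | h1) t ht h2
    · exact Or.inl ⟨rfl, h'.cu t ht h2⟩
    · exact Or.inr ((hA s h1 t ht).2 h2)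

lemma no_pyramid (hG : InC G) {c a₁ b₁ a₂ b₂ a₃ b₃ : V} {S₁ S₂ S₃ : Set V}
    (h₁ : PLeg G c a₁ b₁ S₁) (h₂ : PLeg G c a₂ b₂ S₂) (h₃ : PLeg G c a₃ b₃ S₃)
    (hb12 : G.Adj b₁ b₂) (hb13 : G.Adj b₁ b₃) (hb23 : G.Adj b₂ b₃)
    (n12 : ¬ (a₁ = b₁ ∧ a₂ = b₂)) (n13 : ¬ (a₁ = b₁ ∧ a₃ = b₃)) (n23 : ¬ (a₂ = b₂ ∧ a₃ = b₃))
    (h12 : OneEdge G b₁ b₂ S₁ S₂) (h13 : OneEdge G b₁ b₃ S₁ S₃) (h23 : OneEdge G b₂ b₃ S₂ S₃) :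
    False := by
  obtain ⟨w₁, p₁, s₁⟩ := h₁.full.walk
  obtain ⟨w₂, p₂, s₂⟩ := h₂.full.walk
  obtain ⟨w₃, p₃, s₃⟩ := h₃.full.walk
  refine hG.2.2.2.1 ⟨c, b₁, b₂, b₃, w₁, w₂, w₃, hb12, hb13, hb23, ?_, ?_, ?_, p₁, p₂, p₃, ?_, ?_, ?_⟩
  · rintro rfl; exact h₁.hc h₁.ip.right_mem
  · rintro rfl; exact h₂.hc h₂.ip.right_mem
  · rintro rfl; exact h₃.hc h₃.ip.right_mem
  · have := h₁.pair h₂ hb12 n12 h12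
    unfold PairHole
    convert this using 1
    ext v
    simp only [s₁, s₂, Set.mem_setOf_eq, Set.mem_union, Set.mem_insert_iff]
    tauto
  · have := h₁.pair h₃ hb13 n13 h13
    unfold PairHole
    convert this using 1
    ext v
    simp only [s₁, s₃, Set.mem_setOf_eq, Set.mem_union, Set.mem_insert_iff]
    tauto
  · have := h₂.pair h₃ hb23 n23 h23
    unfold PairHole
    convert this using 1
    ext v
    simp only [s₂, s₃, Set.mem_setOf_eq, Set.mem_union, Set.mem_insert_iff]
    tauto

lemma no_C4 (hG : InC G) {a b c d : V} (hab : G.Adj a b) (hbc : G.Adj b c) (hcd : G.Adj c d)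
    (hda : G.Adj d a) (hac : ¬ G.Adj a c) (hbd : ¬ G.Adj b d) (nac : a ≠ c) (nbd : b ≠ d) :
    False := by
  refine hG.1 ⟨Set.range ![a, b, c, d], ⟨?_⟩⟩
  have hinj : Function.Injective ![a, b, c, d] := by
    intro i j hij
    have := hab.ne
    have := hbc.ne
    have := hcd.ne
    have := hda.ne
    fin_cases i <;> fin_cases j <;> simp_all
  refine (⟨Equiv.ofInjective _ hinj, ?_⟩ : cycleGraph 4 ≃g _).symm
  intro i j
  rw [comap_adj, cycleGraph_adj']
  have := hab.symm
  have := hbc.symm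
  have := hcd.symm
  have := hda.symm
  have hca : ¬ G.Adj c a := fun h => hac h.symm
  have hdb : ¬ G.Adj d b := fun h => hbd h.symm
  fin_cases i <;> fin_cases j <;> simp_all <;> decide

lemma no_diamond (hG : InC G) {a b c d : V} (hcd : G.Adj c d) (hac : G.Adj a c) (had : G.Adj a d)
    (hbc : G.Adj b c) (hbd : G.Adj b d) (hab : ¬ G.Adj a b) (nab : a ≠ b) :
    False := by
  refine hG.2.1 ⟨Set.range ![a, b, c, d], ⟨?_⟩⟩
  have hinj : Function.Injective ![a, b, c, d] := by
    intro i j hij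
    have := hac.ne
    have := hbc.ne
    have := hcd.ne
    have := had.ne
    have := hbd.ne
    fin_cases i <;> fin_cases j <;> simp_all
  refine (⟨Equiv.ofInjective _ hinj, ?_⟩ : diamond ≃g _).symm
  intro i j
  rw [comap_adj]
  have := hac.symm
  have := hbc.symm
  have := hcd.symm
  have := had.symm
  have := hbd.symm
  have hba : ¬ G.Adj b a := fun h => hab h.symm
  fin_cases i <;> fin_cases j <;> simp_all [diamond]

/-- Two distinct nonadjacent vertices have at most one common neighbor. -/
lemma common (hG : InC G) {u w p q : V} (huw : u ≠ w) (hn : ¬ G.Adj u w) (hpu : G.Adj u p)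
    (hpw : G.Adj w p) (hqu : G.Adj u q) (hqw : G.Adj w q) : p = q := by
  by_contra hne
  by_cases hpq : G.Adj p q
  · exact no_diamond hG hpq hpu hqu hpw hqw hn huw
  · exact no_C4 hG hpu hpw.symm hqw hqu.symm hn hpq huw hne

/-- A path attached to a hole. -/
lemma link_core (hG : InC G) {c p q : V} {S : Set V} (hS : IP G p q S) (hc : c ∉ S)
    (hpq : p ≠ q) (hnpq : ¬ G.Adj p q) (hcp : G.Adj c p) (hcq : G.Adj c q)
    (hcu : ∀ s ∈ S, G.Adj c s → s = p ∨ s = q) {r₁ rl : V} {R : Set V} (hR : IP G r₁ rl R)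
    (hcR : c ∉ R) (hRS : ∀ r ∈ R, r ∉ S) (hcr : G.Adj c r₁) (hcru : ∀ r ∈ R, G.Adj c r → r = r₁)
    (hRa : ∀ r ∈ R, ∀ s ∈ S, G.Adj r s → r = rl) (hz : ∃ z ∈ S, G.Adj rl z ∧ ¬ G.Adj c z)
    (hend : r₁ ≠ rl ∨ ((∀ s ∈ S, G.Adj rl s → ¬ G.Adj c s) ∧
      ∀ s ∈ S, ∀ t ∈ S, G.Adj rl s → G.Adj rl t → s = t ∨ G.Adj s t)) : False := by
  obtain ⟨z₁, S₁, S₂, rfl, hd, hS₁, hz₁, hu₁, hr⟩ := hS.first (fun s => G.Adj rl s)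
    (by obtain ⟨z, h1, h2, _⟩ := hz; exact ⟨z, h1, h2⟩)
  have hz1m := hS₁.right_mem
  have hp1 := hS₁.left_mem
  by_cases hN : ∃ s ∈ S₂, G.Adj rl s
  · obtain ⟨s₀, hs₀, hs₀'⟩ := hN
    rcases hr with ⟨rfl, _⟩ | ⟨hq1, z', hz', hzz, he⟩
    · exact hs₀
    obtain ⟨z₂, S₃, M, rfl, hd', hS₃, hz₂, hu₂, hr'⟩ := hz'.symm.first (fun s => G.Adj rl s)
      ⟨s₀, hs₀, hs₀'⟩
    have hz2m := hS₃.right_mem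
    rcases hr' with ⟨rfl, rfl⟩ | ⟨hz'3, m, hm, hzm, he'⟩
    · refine no_pyramid hG (c := c) (a₁ := p) (b₁ := z₁) (a₂ := q) (b₂ := z₂) (a₃ := r₁) (b₃ := rl)
        (S₁ := S₁) (S₂ := S₃) (S₃ := R) ⟨hS₁, ?_, hcp, ?_⟩ ⟨hS₃, ?_, hcq, ?_⟩ ⟨hR, hcR, hcr, hcru⟩
        hzz hz₁.symm hz₂.symm ?_ ?_ ?_ ?_ ?_ ?_
      all_goals (try unfold OneEdge)
      · grind
      · have := hS₃.left_mem
        grind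
      · grind
      · grind
      · rintro ⟨rfl, rfl⟩; exact hnpq hzz
      · rintro ⟨rfl, rfl⟩
        rcases hend with h | h
        · exact h rfl
        · exact h.1 _ (Or.inl hp1) hz₁ hcp
      · rintro ⟨rfl, rfl⟩
        rcases hend with h | h
        · exact h rfl
        · exact h.1 _ (Or.inr (Or.inl hz2m)) hz₂ hcq
      · grind
      · intro s hs t ht
        have h1 := hRS t ht
        have h2 := hRa t ht s (Or.inl hs)
        have h3 := hu₁ s hs
        simp only [Set.mem_union] at h1
        refine ⟨fun h => h1 (Or.inl (h ▸ hs)), fun h => ?_⟩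
        have h4 := h2 h.symm
        subst h4
        exact ⟨h3 h.symm, rfl⟩
      · intro s hs t ht
        have h1 := hRS t ht
        have h2 := hRa t ht s (Or.inr (Or.inl hs))
        have h3 := hu₂ s hs
        simp only [Set.mem_union] at h1
        refine ⟨fun h => h1 (Or.inr (Or.inl (h ▸ hs))), fun h => ?_⟩
        have h4 := h2 h.symm
        subst h4
        exact ⟨h3 h.symm, rfl⟩
    · have hne : r₁ ≠ rl := by
        rcases hend with h | h
        · exact h
        · exfalso
          rcases h.2 z₁ (Or.inl hz1m) z₂ (Or.inr (Or.inl hz2m)) hz₁ hz₂ with h1 | h1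
          · exact hd z₁ hz1m (Or.inl (h1 ▸ hz2m))
          · have := (he z₁ hz1m z₂ (Or.inl hz2m) h1).2
            exact hz'3 (this ▸ hz2m)
      obtain ⟨r', hR', hrr', hru'⟩ := hR.symm.tail hne.symm
      have hrlR := hR.right_mem
      have hrlS := hRS rl hrlR
      have hcrl : ¬ G.Adj c rl := fun h => hne (hcru rl hrlR h).symm
      have hcne : c ≠ rl := fun h => hcR (h ▸ hrlR)
      refine no_theta hG (c := c) (z := rl) (S₁ := S₁) (S₂ := S₃) (S₃ := R \ {rl}) hcne hcrl
        ⟨hS₁, fun h => hc (Or.inl h), fun h => hrlS (Or.inl h), hcp, hz₁, ?_, hu₁⟩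
        ⟨hS₃, fun h => hc (Or.inr (Or.inl h)), fun h => hrlS (Or.inr (Or.inl h)), hcq, hz₂, ?_, hu₂⟩
        ⟨hR'.symm, fun h => hcR h.1, fun h => h.2 rfl, hcr, hrr', fun s hs => hcru s hs.1,
          fun s hs => hru' s hs.1⟩ ?_ ?_ ?_
      · have := hS₃.left_mem
        grind
      · grind
      · intro s hs t ht
        refine ⟨fun h => hd s hs (Or.inl (h ▸ ht)), fun h => ?_⟩
        have := (he s hs t (Or.inl ht) h).2
        exact hz'3 (this ▸ ht)
      · intro s hs t ht
        refine ⟨fun h => hRS t ht.1 (Or.inl (h ▸ hs)), fun h => ht.2 ?_⟩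
        exact hRa t ht.1 s (Or.inl hs) h.symm
      · intro s hs t ht
        refine ⟨fun h => hRS t ht.1 (Or.inr (Or.inl (h ▸ hs))), fun h => ht.2 ?_⟩
        exact hRa t ht.1 s (Or.inr (Or.inl hs)) h.symm
  · have huniq : ∀ s ∈ S₁ ∪ S₂, G.Adj rl s → s = z₁ := by
      rintro s (h1 | h1) h2
      · exact hu₁ s h1 h2
      · exact absurd ⟨s, h1, h2⟩ hN
    obtain ⟨z, hzm, hrz, hcz⟩ := hz
    have := huniq z hzm hrz
    subst this
    have hzp : p ≠ z := by rintro rfl; exact hcz hcp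
    have hzq : z ≠ q := by rintro rfl; exact hcz hcq
    rcases hr with ⟨_, h⟩ | ⟨hq1, z', hz', hzz, he⟩
    · exact hzq h
    obtain ⟨b', hb', hzb, hub⟩ := hS₁.symm.tail hzp.symm
    refine no_theta hG (c := c) (z := z) (S₁ := S₁ \ {z}) (S₂ := S₂) (S₃ := R) ?_ hcz
      ⟨hb'.symm, fun h => hc (Or.inl h.1), fun h => h.2 rfl, hcp, hzb, ?_, fun s hs => hub s hs.1⟩
      ⟨hz'.symm, fun h => hc (Or.inr h), hd z hz1m, hcq, hzz, ?_, ?_⟩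
      ⟨hR, hcR, fun h => hRS z h (Or.inl hz1m), hcr, hrz.symm, hcru, ?_⟩ ?_ ?_ ?_
    · rintro rfl; exact hc (Or.inl hz1m)
    · rintro s ⟨hs, _⟩ h
      rcases hcu s (Or.inl hs) h with h1 | h1
      · exact h1
      · exact absurd (h1 ▸ hs) hq1
    · intro s hs h
      rcases hcu s (Or.inr hs) h with h1 | h1
      · exact absurd (h1 ▸ hs) (hd p hp1)
      · exact h1
    · intro s hs h
      exact (he z hz1m s hs h).2
    · intro s hs h
      exact hRa s hs z (Or.inl hz1m) h.symm
    · rintro s ⟨hs, hsz⟩ t ht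
      exact ⟨fun h => hd s hs (h ▸ ht), fun h => hsz (he s hs t ht h).1⟩
    · rintro s ⟨hs, hsz⟩ t ht
      refine ⟨fun h => hRS t ht (Or.inl (h ▸ hs)), fun h => hsz ?_⟩
      have := hRa t ht s (Or.inl hs) h.symm
      subst this
      exact hu₁ s hs h.symm
    · intro s hs t ht
      refine ⟨fun h => hRS t ht (Or.inr (h ▸ hs)), fun h => hN ⟨s, hs, ?_⟩⟩
      have := hRa t ht s (Or.inr hs) h.symm
      subst this
      exact h.symm

/-- A long path attached to a hole. -/
lemma linkL (hG : InC G) {c : V} {C : Set V} (hC : HoleAt G c C) {r₁ rl : V} {R : Set V}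
    (hR : IP G r₁ rl R) (hne : r₁ ≠ rl) (hRC : ∀ r ∈ R, r ∉ C) (hcr : G.Adj c r₁)
    (hcru : ∀ r ∈ R, G.Adj c r → r = r₁)
    (hRa : ∀ r ∈ R, ∀ s ∈ C, s ≠ c → G.Adj r s → r = rl)
    (hz : ∃ z ∈ C, z ≠ c ∧ G.Adj rl z ∧ ¬ G.Adj c z) : False := by
  obtain ⟨hc, p, q, hP, hpq, hnpq, hcp, hcq, hu⟩ := hC
  refine link_core hG hP (fun h => h.2 rfl) hpq hnpq hcp hcq (fun s hs => hu s hs.1) hR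
    (fun h => hRC c h hc) (fun r hr h => hRC r hr h.1) hcr hcru
    (fun r hr s hs => hRa r hr s hs.1 hs.2) ?_ (Or.inl hne)
  obtain ⟨z, h1, h2, h3, h4⟩ := hz
  exact ⟨z, ⟨h1, h2⟩, h3, h4⟩

/-- A vertex attached to a hole: one vertex and one vertex or edge away from it. -/
lemma linkW (hG : InC G) {c : V} {C : Set V} (hC : HoleAt G c C) {u : V} (hu : u ∉ C)
    (hcu : G.Adj c u) (h1 : ∀ s ∈ C, s ≠ c → G.Adj u s → ¬ G.Adj c s)
    (h2 : ∀ s ∈ C, s ≠ c → ∀ t ∈ C, t ≠ c → G.Adj u s → G.Adj u t → s = t ∨ G.Adj s t)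
    (hz : ∃ z ∈ C, z ≠ c ∧ G.Adj u z) : False := by
  obtain ⟨hc, p, q, hP, hpq, hnpq, hcp, hcq, hu'⟩ := hC
  refine link_core hG hP (fun h => h.2 rfl) hpq hnpq hcp hcq (fun s hs => hu' s hs.1)
    (IP.single u) ?_ ?_ hcu ?_ ?_ ?_ (Or.inr ⟨fun s hs => h1 s hs.1 hs.2,
      fun s hs t ht => h2 s hs.1 hs.2 t ht.1 ht.2⟩)
  · rintro rfl; exact hu hc
  · rintro r rfl h; exact hu h.1
  · rintro r rfl _; rfl
  · rintro r rfl _ _ _; rfl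
  · obtain ⟨z, hz1, hz2, hz3⟩ := hz
    exact ⟨z, ⟨hz1, hz2⟩, hz3, h1 z hz1 hz2 hz3⟩

/-- A vertex with two nonadjacent neighbors in a hole has an odd number of them. -/
lemma parity [Finite V] (hG : InC G) {c : V} {C : Set V} (hC : HoleAt G c C) {u d : V} (hu : u ∉ C)
    (hcu : G.Adj c u) (hd : d ∈ C) (hdc : d ≠ c) (hud : G.Adj u d) (hcd : ¬ G.Adj c d) :
    Odd (nbrsIn G C u).ncard := by
  by_contra hodd
  rw [Nat.not_odd_iff_even] at hodd
  have hsub : ({c, d} : Set V) ⊆ nbrsIn G C u := by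
    rintro s (rfl | rfl)
    · exact ⟨hC.1, hcu.symm⟩
    · exact ⟨hd, hud⟩
  have h2 : ({c, d} : Set V).ncard = 2 := Set.ncard_pair hdc.symm
  have hle := Set.ncard_le_ncard hsub (Set.toFinite _)
  by_cases h3 : 3 ≤ (nbrsIn G C u).ncard
  · exact hG.2.2.2.2.2 ⟨C, u, ⟨hC.isHoleSet, hu, h3⟩, hodd⟩
  · have heq : ({c, d} : Set V) = nbrsIn G C u :=
      Set.eq_of_subset_of_ncard_le hsub (by omega) (Set.toFinite _)
    have key : ∀ s ∈ C, s ≠ c → G.Adj u s → s = d := by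
      intro s hs hsc hus
      have : s ∈ ({c, d} : Set V) := heq ▸ ⟨hs, hus⟩
      rcases this with h | h
      · exact absurd h hsc
      · exact h
    refine linkW hG hC hu hcu ?_ ?_ ⟨d, hd, hdc, hud⟩
    · intro s hs hsc hus
      rw [key s hs hsc hus]; exact hcd
    · intro s hs hsc t ht htc hus hut
      left; rw [key s hs hsc hus, key t ht htc hut]

end Forbidden

/-! ### Connected sets and extraction of induced paths -/

section Connectivity
variable {G : SimpleGraph V}

/-- `D` induces a connected (or empty) subgraph. -/
def Conn (G : SimpleGraph V) (D : Set V) : Prop :=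
  ∀ a ∈ D, ∀ b ∈ D, Relation.ReflTransGen (fun u w => u ∈ D ∧ w ∈ D ∧ G.Adj u w) a b

lemma reach_IP {D : Set V} {a b : V}
    (h : Relation.ReflTransGen (fun u w => u ∈ D ∧ w ∈ D ∧ G.Adj u w) a b) (ha : a ∈ D) :
    ∃ S, S ⊆ D ∧ IP G a b S := by
  induction h with
  | refl => exact ⟨{a}, by simpa using ha, IP.single a⟩
  | @tail b c _ hbc ih =>
    obtain ⟨S, hSD, hS⟩ := ih
    obtain ⟨z, S₁, S₂, rfl, hd, hS₁, hz, hu, -⟩ := hS.first (fun s => s = c ∨ G.Adj s c)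
      ⟨b, hS.right_mem, Or.inr hbc.2.2⟩
    by_cases hzc : z = c
    · subst hzc
      exact ⟨S₁, fun s hs => hSD (Or.inl hs), hS₁⟩
    · have hzc' : G.Adj z c := hz.resolve_left hzc
      refine ⟨S₁ ∪ {c}, ?_, hS₁.append (IP.single c) hzc' ?_ ?_⟩
      · rintro s (hs | rfl)
        · exact hSD (Or.inl hs)
        · exact hbc.2.1
      · rintro s hs rfl
        exact hzc (hu s hs (Or.inl rfl)).symm
      · rintro s hs t rfl hst
        exact ⟨hu s hs (Or.inr hst), rfl⟩

lemma Conn.extract {D : Set V} (hD : Conn G D) (P P' : V → Prop) (hP : ∃ a ∈ D, P a)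
    (hP' : ∃ b ∈ D, P' b) :
    ∃ p q Q, Q ⊆ D ∧ IP G p q Q ∧ P p ∧ P' q ∧ (∀ s ∈ Q, P s → s = p) ∧
      (∀ s ∈ Q, P' s → s = q) := by
  obtain ⟨a, ha, hPa⟩ := hP
  obtain ⟨b, hb, hPb⟩ := hP'
  obtain ⟨S, hSD, hS⟩ := reach_IP (hD a ha b hb) ha
  obtain ⟨z, S₁, S₂, rfl, -, hS₁, hz, hu, -⟩ := hS.first P' ⟨b, hS.right_mem, hPb⟩
  obtain ⟨w, S₃, S₄, rfl, -, hS₃, hw, hu', -⟩ := hS₁.symm.first P ⟨a, hS₁.left_mem, hPa⟩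
  exact ⟨w, z, S₃, fun s hs => hSD (Or.inl (Or.inl hs)), hS₃.symm, hw, hz, hu',
    fun s hs => hu s (Or.inl hs)⟩

lemma Conn.mono_rel {D E : Set V} (h : D ⊆ E) {a b : V}
    (hab : Relation.ReflTransGen (fun u w => u ∈ D ∧ w ∈ D ∧ G.Adj u w) a b) :
    Relation.ReflTransGen (fun u w => u ∈ E ∧ w ∈ E ∧ G.Adj u w) a b := by
  induction hab with
  | refl => exact Relation.ReflTransGen.refl
  | tail _ h' ih => exact ih.tail ⟨h h'.1, h h'.2.1, h'.2.2⟩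

lemma Conn.union {A B : Set V} (hA : Conn G A) (hB : Conn G B) {u w : V} (hu : u ∈ A)
    (hw : w ∈ B) (huw : G.Adj u w) : Conn G (A ∪ B) := by
  have hl : A ⊆ A ∪ B := Set.subset_union_left
  have hr : B ⊆ A ∪ B := Set.subset_union_right
  have e1 : Relation.ReflTransGen (fun u w => u ∈ A ∪ B ∧ w ∈ A ∪ B ∧ G.Adj u w) u w :=
    Relation.ReflTransGen.single ⟨hl hu, hr hw, huw⟩
  have e2 : Relation.ReflTransGen (fun u w => u ∈ A ∪ B ∧ w ∈ A ∪ B ∧ G.Adj u w) w u :=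
    Relation.ReflTransGen.single ⟨hr hw, hl hu, huw.symm⟩
  rintro a (ha | ha) b (hb | hb)
  · exact Conn.mono_rel hl (hA a ha b hb)
  · exact ((Conn.mono_rel hl (hA a ha u hu)).trans e1).trans (Conn.mono_rel hr (hB w hw b hb))
  · exact ((Conn.mono_rel hr (hB a ha w hw)).trans e2).trans (Conn.mono_rel hl (hA u hu b hb))
  · exact Conn.mono_rel hr (hB a ha b hb)

lemma Conn.empty : Conn G ∅ := fun _ h => absurd h (Set.notMem_empty _)

lemma Conn.singleton (a : V) : Conn G {a} := by
  rintro x rfl y rfl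
  exact Relation.ReflTransGen.refl

lemma IP.conn {a b : V} {S : Set V} (h : IP G a b S) : Conn G S := by
  induction h with
  | single a => exact Conn.singleton a
  | @cons a b c S hab h ha hs ih =>
    have := (Conn.singleton (G := G) a).union ih rfl h.left_mem hab
    rwa [Set.singleton_union] at this

lemma IP.conn_left {a b : V} {S : Set V} (h : IP G a b S) : Conn G (S \ {a}) := by
  by_cases hab : a = b
  · subst hab
    rw [h.eq_single]
    simpa using Conn.empty
  · obtain ⟨c, hc, -, -⟩ := h.tail hab
    exact hc.conn

lemma IP.conn_int {a b : V} {S : Set V} (h : IP G a b S) : Conn G (S \ {a, b}) := by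
  by_cases hab : a = b
  · subst hab
    rw [h.eq_single]
    simpa using Conn.empty
  · obtain ⟨c, hc, -, -⟩ := h.tail hab
    have := hc.symm.conn_left
    rwa [Set.sdiff_sdiff, Set.singleton_union] at this

end Connectivity

/-! ### Holes split by a wheel center, and links between the two sides -/

section WheelLemma
variable {G : SimpleGraph V}

/-- A hole `S ∪ T`, whose part `S` is a sector for the vertex `y`. -/
structure Cfg (G : SimpleGraph V) (y x₁ x₂ t₁ t₂ : V) (S T : Set V) : Prop where
  hS : IP G x₁ x₂ S
  hT : IP G t₁ t₂ T
  disj : ∀ s ∈ S, s ∉ T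
  e₁ : G.Adj x₁ t₁
  e₂ : G.Adj x₂ t₂
  he : ∀ s ∈ S, ∀ t ∈ T, G.Adj s t → (s = x₁ ∧ t = t₁) ∨ (s = x₂ ∧ t = t₂)
  yS : y ∉ S
  yT : y ∉ T
  y₁ : G.Adj y x₁
  y₂ : G.Adj y x₂
  yu : ∀ s ∈ S, G.Adj y s → s = x₁ ∨ s = x₂
  ne : x₁ ≠ x₂
  na : ¬ G.Adj x₁ x₂

variable {y x₁ x₂ t₁ t₂ : V} {S T : Set V}

lemma Cfg.symm (h : Cfg G y x₁ x₂ t₁ t₂ S T) : Cfg G y x₂ x₁ t₂ t₁ S T where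
  hS := h.hS.symm
  hT := h.hT.symm
  disj := h.disj
  e₁ := h.e₂
  e₂ := h.e₁
  he := fun s hs t ht hst => (h.he s hs t ht hst).symm
  yS := h.yS
  yT := h.yT
  y₁ := h.y₂
  y₂ := h.y₁
  yu := fun s hs hys => (h.yu s hs hys).symm
  ne := h.ne.symm
  na := fun h' => h.na h'.symm

lemma Cfg.hole (h : Cfg G y x₁ x₂ t₁ t₂ S T) : HoleAt G x₁ (S ∪ T) :=
  HoleAt.of_two h.hS h.hT h.disj h.e₁ h.e₂ h.ne (Or.inl h.na) h.he

lemma Cfg.tne (h : Cfg G y x₁ x₂ t₁ t₂ S T) (hG : InC G) : t₁ ≠ t₂ := by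
  intro e
  have h2 := h.e₂
  rw [← e] at h2
  have := common hG h.ne h.na h.y₁.symm h.y₂.symm h.e₁ h2
  exact h.yT (this ▸ h.hT.left_mem)

lemma Cfg.not12 (h : Cfg G y x₁ x₂ t₁ t₂ S T) (hG : InC G) : ¬ G.Adj x₁ t₂ := by
  intro h'
  rcases h.he _ h.hS.left_mem _ h.hT.right_mem h' with e | e
  · exact h.tne hG e.2.symm
  · exact h.ne e.1

lemma Cfg.odd [Finite V] (h : Cfg G y x₁ x₂ t₁ t₂ S T) (hG : InC G) :
    Odd (nbrsIn G T y).ncard := by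
  have hp := parity hG h.hole (u := y) (d := x₂) (by have := h.yS; have := h.yT; grind)
    h.y₁.symm (Or.inl h.hS.right_mem) h.ne.symm h.y₂ h.na
  have e : nbrsIn G (S ∪ T) y = insert x₁ (insert x₂ (nbrsIn G T y)) := by
    ext s
    have h1 := h.yu s
    have h2 := h.y₁
    have h3 := h.y₂
    have h4 := h.hS.left_mem
    have h5 := h.hS.right_mem
    simp only [nbrsIn, Set.mem_setOf_eq, Set.mem_insert_iff, Set.mem_union]
    grind
  rw [e, Set.ncard_insert_of_notMem _ (Set.toFinite _),
    Set.ncard_insert_of_notMem _ (Set.toFinite _)] at hp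
  · simp only [parity_simps] at hp
    grind
  · exact fun h' => h.disj _ h.hS.right_mem h'.1
  · rintro (h' | h')
    · exact h.ne h'
    · exact h.disj _ h.hS.left_mem h'.1

lemma Cfg.not_only (h : Cfg G y x₁ x₂ t₁ t₂ S T) (hG : InC G)
    (hX : nbrsIn G T y = {t₂}) : False := by
  have key : ∀ s ∈ S ∪ T, s ≠ x₁ → G.Adj y s → s = x₂ ∨ s = t₂ := by
    rintro s (hs | hs) hsx hys
    · exact Or.inl ((h.yu s hs hys).resolve_left hsx)
    · right
      have : s ∈ nbrsIn G T y := ⟨hs, hys⟩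
      rw [hX] at this
      exact this
  refine linkW hG h.hole (u := y) ?_ h.y₁.symm ?_ ?_ ⟨x₂, Or.inl h.hS.right_mem, h.ne.symm, h.y₂⟩
  · have := h.yS; have := h.yT; grind
  · intro s hs hsx hys
    rcases key s hs hsx hys with rfl | rfl
    · exact h.na
    · exact h.not12 hG
  · intro s hs hsx t ht htx hys hyt
    have := h.e₂
    have := h.e₂.symm
    rcases key s hs hsx hys with rfl | rfl <;> rcases key t ht htx hyt with rfl | rfl <;>
      first | exact Or.inl rfl | exact Or.inr (by assumption)

lemma Cfg.exists_x3 [Finite V] (h : Cfg G y x₁ x₂ t₁ t₂ S T) (hG : InC G) :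
    ∃ x₃ ∈ T, x₃ ≠ t₁ ∧ x₃ ≠ t₂ ∧ G.Adj y x₃ := by
  by_contra hcon
  have key : ∀ s ∈ T, G.Adj y s → s = t₁ ∨ s = t₂ := by
    intro s hs hys
    by_contra h'
    exact hcon ⟨s, hs, fun e => h' (Or.inl e), fun e => h' (Or.inr e), hys⟩
  have hodd := h.odd hG
  have m1 := h.hT.left_mem
  have m2 := h.hT.right_mem
  by_cases a1 : G.Adj y t₁ <;> by_cases a2 : G.Adj y t₂
  · have : nbrsIn G T y = {t₁, t₂} := by
      ext s
      have := key s
      simp only [nbrsIn, Set.mem_setOf_eq, Set.mem_insert_iff, Set.mem_singleton_iff]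
      grind
    rw [this, Set.ncard_pair (h.tne hG)] at hodd
    exact absurd hodd (by decide)
  · apply h.symm.not_only hG
    ext s
    have := key s
    simp only [nbrsIn, Set.mem_setOf_eq, Set.mem_singleton_iff]
    grind
  · apply h.not_only hG
    ext s
    have := key s
    simp only [nbrsIn, Set.mem_setOf_eq, Set.mem_singleton_iff]
    grind
  · have : nbrsIn G T y = ∅ := by
      ext s
      have := key s
      simp only [nbrsIn, Set.mem_setOf_eq, Set.mem_empty_iff_false]
      grind
    rw [this, Set.ncard_empty] at hodd
    exact absurd hodd (by decide)

lemma Cfg.nat [Finite V] (h : Cfg G y x₁ x₂ t₁ t₂ S T) (hG : InC G) : ¬ G.Adj t₁ t₂ := by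
  intro h'
  obtain ⟨x₃, h3, h31, h32, -⟩ := h.exists_x3 hG
  obtain ⟨c, hc, -, hcu⟩ := h.hT.tail (h.tne hG)
  have := hcu _ h.hT.right_mem h'
  subst this
  have := hc.eq_single
  have hmem3 : x₃ ∈ T \ {t₁} := ⟨h3, h31⟩
  rw [this] at hmem3
  exact h32 hmem3

/-- A tight link between the interior of `S` and `T`. -/
structure Link (G : SimpleGraph V) (y x₁ x₂ q₁ q₂ : V) (S T Q : Set V) : Prop where
  hQ : IP G q₁ q₂ Q
  nS : ∀ q ∈ Q, q ∉ S
  nT : ∀ q ∈ Q, q ∉ T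
  ny : ∀ q ∈ Q, q ≠ y
  nay : ∀ q ∈ Q, ¬ G.Adj y q
  h₁ : ∃ s ∈ S, s ≠ x₁ ∧ s ≠ x₂ ∧ G.Adj q₁ s
  h₂ : ∃ t ∈ T, G.Adj q₂ t

/-- Minimality of a link. -/
structure Tight (G : SimpleGraph V) (x₁ x₂ q₁ q₂ : V) (S T Q : Set V) : Prop where
  uS : ∀ q ∈ Q, ∀ s ∈ S, s ≠ x₁ → s ≠ x₂ → G.Adj q s → q = q₁
  uT : ∀ q ∈ Q, ∀ t ∈ T, G.Adj q t → q = q₂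

variable {q₁ q₂ : V} {Q : Set V}

lemma Link.symm (h : Link G y x₁ x₂ q₁ q₂ S T Q) : Link G y x₂ x₁ q₁ q₂ S T Q where
  hQ := h.hQ
  nS := h.nS
  nT := h.nT
  ny := h.ny
  nay := h.nay
  h₁ := by obtain ⟨s, a, b, c, d⟩ := h.h₁; exact ⟨s, a, c, b, d⟩
  h₂ := h.h₂

lemma Tight.symm (h : Tight G x₁ x₂ q₁ q₂ S T Q) : Tight G x₂ x₁ q₁ q₂ S T Q where
  uS := fun q hq s hs a b => h.uS q hq s hs b a
  uT := h.uT

lemma step1 [Finite V] (hG : InC G) (h : Cfg G y x₁ x₂ t₁ t₂ S T) (l : Link G y x₁ x₂ q₁ q₂ S T Q)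
    (ti : Tight G x₁ x₂ q₁ q₂ S T Q) : ∃ t ∈ T, G.Adj q₂ t ∧ t ≠ t₁ := by
  by_contra hcon
  have key : ∀ t ∈ T, G.Adj q₂ t → t = t₁ := by
    intro t ht h'
    by_contra h''
    exact hcon ⟨t, ht, h', h''⟩
  have hq2 : G.Adj q₂ t₁ := by
    obtain ⟨t, ht, h'⟩ := l.h₂
    have := key t ht h'
    rwa [this] at h'
  obtain ⟨s, hs, hs1, hs2, hqs⟩ := l.h₁
  have hconn : Conn G (Q ∪ S \ {x₁}) := l.hQ.conn.union h.hS.conn_left l.hQ.left_mem ⟨hs, hs1⟩ hqs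
  obtain ⟨p, q, U, hUD, hU, rfl, rfl, -, -⟩ := hconn.extract (fun v => v = q₂) (fun v => v = x₂)
    ⟨q₂, Or.inl l.hQ.right_mem, rfl⟩ ⟨x₂, Or.inr ⟨h.hS.right_mem, h.ne.symm⟩, rfl⟩
  have hq2S : p ∉ S := l.nS _ l.hQ.right_mem
  obtain ⟨x₃, h3, h31, h32, hy3⟩ := h.exists_x3 hG
  have hUS : ∀ u ∈ U, u ∈ Q ∨ (u ∈ S ∧ u ≠ x₁) := hUD
  have hC : HoleAt G q (U ∪ T) := by
    refine HoleAt.of_two hU.symm h.hT.symm ?_ h.e₂ hq2 ?_ (Or.inr (h.tne hG).symm) ?_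
    · intro u hu
      rcases hUS u hu with h1 | h1
      · exact l.nT u h1
      · exact h.disj u h1.1
    · rintro rfl
      exact hq2S h.hS.right_mem
    · intro u hu t ht hut
      rcases hUS u hu with h1 | h1
      · right
        have := ti.uT u h1 t ht hut
        subst this
        exact ⟨rfl, key t ht hut⟩
      · left
        exact (h.he u h1.1 t ht hut).resolve_left (fun h' => h1.2 h'.1)
  have hp := parity hG hC (u := y) (d := x₃) ?_ h.y₂.symm (Or.inr h3) ?_ hy3 ?_
  · have e : nbrsIn G (U ∪ T) y = insert q (nbrsIn G T y) := by
      ext s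
      have h1 := h.yu s
      have h2 := hUS s
      have h3 := h.y₂
      have h4 := hU.right_mem
      have h5 := l.nay s
      simp only [nbrsIn, Set.mem_setOf_eq, Set.mem_insert_iff, Set.mem_union]
      grind
    rw [e, Set.ncard_insert_of_notMem _ (Set.toFinite _)] at hp
    · have := h.odd hG
      rw [Nat.odd_add_one] at hp
      exact hp this
    · exact fun h' => h.disj _ h.hS.right_mem h'.1
  · rintro (hy | hy)
    · rcases hUS y hy with h1 | h1
      · exact l.ny y h1 rfl
      · exact h.yS h1.1
    · exact h.yT hy
  · rintro rfl
    exact h.disj _ h.hS.right_mem h3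
  · intro h'
    rcases h.he _ h.hS.right_mem _ h3 h' with h1 | h1
    · exact h.ne h1.1.symm
    · exact h32 h1.2

lemma step2core (hG : InC G) (h : Cfg G y x₁ x₂ t₁ t₂ S T) {z z' : V} {Q₂ Q₃ : Set V}
    (hQ₂ : IP G q₂ z Q₂) (hQ₃ : IP G z' q₁ Q₃) (hzz : G.Adj z z')
    (hd : ∀ q ∈ Q₂, q ∉ Q₃) (l : Link G y x₁ x₂ q₁ q₂ S T (Q₂ ∪ Q₃))
    (ti : Tight G x₁ x₂ q₁ q₂ S T (Q₂ ∪ Q₃)) (hq1 : q₁ ∉ Q₂) (hzx : G.Adj z x₁)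
    (hu : ∀ q ∈ Q₂, G.Adj q x₁ ∨ G.Adj q x₂ → q = z)
    (hw : ∃ t ∈ T, G.Adj q₂ t ∧ t ≠ t₁) :
    ∃ T', Cfg G y x₁ x₂ z t₂ S T' ∧ Link G y x₁ x₂ q₁ z' S T' Q₃ := by
  obtain ⟨t, ht, hqt, htne⟩ := hw
  have hzx2 : ¬ G.Adj z x₂ := by
    intro h'
    have hz : z ∈ Q₂ ∪ Q₃ := Or.inl hQ₂.right_mem
    exact h.ne (common hG (l.ny z hz).symm (l.nay z hz) h.y₁ hzx h.y₂ h')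
  obtain ⟨w, T₂, T₃, hTT, -, hT₂, hw, hwu, hrest⟩ := h.hT.symm.first (fun s => G.Adj q₂ s)
    ⟨t, ht, hqt⟩
  have ht1 : t₁ ∉ T₂ := by
    rcases hrest with ⟨e, e'⟩ | h'
    · exfalso
      apply htne
      subst e e'
      rw [Set.union_empty] at hTT
      exact hwu t (hTT ▸ ht) hqt
    · exact h'.1
  have hT2 : ∀ s ∈ T₂, s ∈ T := fun s hs => hTT ▸ Or.inl hs
  have hnew : IP G z t₂ (Q₂ ∪ T₂) := by
    refine hQ₂.symm.append hT₂.symm hw ?_ ?_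
    · intro s hs hs'
      exact l.nT s (Or.inl hs) (hT2 s hs')
    · intro s hs u hu' hsu
      have := ti.uT s (Or.inl hs) u (hT2 u hu') hsu
      subst this
      exact ⟨rfl, hwu u hu' hsu⟩
  refine ⟨Q₂ ∪ T₂, ⟨h.hS, hnew, ?_, hzx.symm, h.e₂, ?_, h.yS, ?_, h.y₁, h.y₂, h.yu, h.ne, h.na⟩,
    ⟨hQ₃.symm, fun q hq => l.nS q (Or.inr hq), ?_, fun q hq => l.ny q (Or.inr hq),
      fun q hq => l.nay q (Or.inr hq), l.h₁, ⟨z, Or.inl hQ₂.right_mem, hzz.symm⟩⟩⟩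
  · rintro s hs (h' | h')
    · exact l.nS s (Or.inl h') hs
    · exact h.disj s hs (hT2 s h')
  · rintro s hs u (hu' | hu') hsu
    · left
      have hsx : s = x₁ ∨ s = x₂ := by
        by_contra h'
        push Not at h'
        have := ti.uS u (Or.inl hu') s hs h'.1 h'.2 hsu.symm
        subst this
        exact hq1 hu'
      rcases hsx with rfl | rfl
      · exact ⟨rfl, hu u hu' (Or.inl hsu.symm)⟩
      · have := hu u hu' (Or.inr hsu.symm)
        subst this
        exact absurd hsu.symm hzx2
    · rcases h.he s hs u (hT2 u hu') hsu with h' | h'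
      · rw [h'.2] at hu'
        exact absurd hu' ht1
      · exact Or.inr h'
  · rintro (h' | h')
    · exact l.ny y (Or.inl h') rfl
    · exact h.yT (hT2 y h')
  · rintro q hq (h' | h')
    · exact hd q h' hq
    · exact l.nT q (Or.inr hq) (hT2 q h')

lemma step2 [Finite V] (hG : InC G) (h : Cfg G y x₁ x₂ t₁ t₂ S T) (l : Link G y x₁ x₂ q₁ q₂ S T Q)
    (ti : Tight G x₁ x₂ q₁ q₂ S T Q)
    (ih : ∀ {a₁ a₂ b₁ b₂ r₁ r₂ : V} {A B R : Set V}, R.ncard < Q.ncard →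
      Cfg G y a₁ a₂ b₁ b₂ A B → Link G y a₁ a₂ r₁ r₂ A B R → False) :
    ∀ q ∈ Q, G.Adj q x₁ ∨ G.Adj q x₂ → q = q₁ := by
  intro q hq hqx
  obtain ⟨z, Q₂, Q₃, rfl, hd, hQ₂, hz, hu, hrest⟩ :=
    l.hQ.symm.first (fun q => G.Adj q x₁ ∨ G.Adj q x₂) ⟨q, hq, hqx⟩
  rcases hrest with ⟨rfl, rfl⟩ | ⟨hq1, z', hQ₃, hzz, he⟩
  · exact hu q (by simpa using hq) hqx
  · exfalso
    have hlt : Q₃.ncard < (Q₂ ∪ Q₃).ncard := by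
      apply Set.ncard_lt_ncard _ (Set.toFinite _)
      refine ⟨Set.subset_union_right, fun h' => ?_⟩
      exact hd z hQ₂.right_mem (h' (Or.inl hQ₂.right_mem))
    rcases hz with hz | hz
    · obtain ⟨T', c, l'⟩ := step2core hG h hQ₂ hQ₃ hzz hd l ti hq1 hz hu (step1 hG h l ti)
      exact ih hlt c l'
    · obtain ⟨T', c, l'⟩ := step2core hG h.symm hQ₂ hQ₃ hzz hd l.symm ti.symm hq1 hz
        (fun q hq h' => hu q hq h'.symm) (step1 hG h.symm l.symm ti.symm)
      exact ih hlt c l'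

lemma Cfg.holeY (h : Cfg G y x₁ x₂ t₁ t₂ S T) : HoleAt G y (insert y S) := by
  refine ⟨Or.inl rfl, x₁, x₂, h.hS.congr ?_, h.ne, h.na, h.y₁, h.y₂, ?_⟩
  · have := h.yS
    ext s
    simp only [Set.mem_diff, Set.mem_insert_iff, Set.mem_singleton_iff]
    grind
  · rintro s (rfl | hs) h'
    · exact absurd h' (G.irrefl)
    · exact h.yu s hs h'

lemma step3 [Finite V] (hG : InC G) (h : Cfg G y x₁ x₂ t₁ t₂ S T)
    (l : Link G y x₁ x₂ q₁ q₂ S T Q) (ti : Tight G x₁ x₂ q₁ q₂ S T Q)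
    (h2 : ∀ q ∈ Q, G.Adj q x₁ ∨ G.Adj q x₂ → q = q₁) {w : V} (hw : w ∈ T) (hw1 : w ≠ t₁)
    (hw2 : w ≠ t₂) (hqw : G.Adj q₂ w) : False := by
  obtain ⟨x₃, h3, h31, h32, hy3⟩ := h.exists_x3 hG
  have hconn : Conn G (Q ∪ T \ {t₁, t₂}) := by
    refine l.hQ.conn.union h.hT.conn_int l.hQ.right_mem ⟨hw, ?_⟩ hqw
    simp [hw1, hw2]
  obtain ⟨p, q, R, hRD, hR, hp, rfl, hpu, -⟩ := hconn.extract (fun v => G.Adj y v)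
    (fun v => v = q₁) ⟨x₃, Or.inr ⟨h3, by simp [h31, h32]⟩, hy3⟩ ⟨q₁, Or.inl l.hQ.left_mem, rfl⟩
  have hRD' : ∀ r ∈ R, r ∈ Q ∨ (r ∈ T ∧ r ≠ t₁ ∧ r ≠ t₂) := by
    intro r hr
    rcases hRD hr with h' | h'
    · exact Or.inl h'
    · right
      have := h'.2
      simp only [Set.mem_insert_iff, Set.mem_singleton_iff, not_or] at this
      exact ⟨h'.1, this⟩
  have hqm := l.hQ.left_mem
  obtain ⟨s, hs, hs1, hs2, hqs⟩ := l.h₁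
  refine linkL hG h.holeY hR ?_ ?_ hp hpu ?_ ⟨s, Or.inr hs, ?_, hqs, ?_⟩
  · rintro rfl
    exact l.nay p hqm hp
  · intro r hr
    rintro (rfl | h')
    · rcases hRD' r hr with h1 | h1
      · exact l.ny r h1 rfl
      · exact h.yT h1.1
    · rcases hRD' r hr with h1 | h1
      · exact l.nS r h1 h'
      · exact h.disj r h' h1.1
  · rintro r hr s (rfl | hs) hsy hrs
    · exact absurd rfl hsy
    · rcases hRD' r hr with h1 | h1
      · by_cases e1 : s = x₁
        · subst e1; exact h2 r h1 (Or.inl hrs)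
        · by_cases e2 : s = x₂
          · subst e2; exact h2 r h1 (Or.inr hrs)
          · exact ti.uS r h1 s hs e1 e2 hrs
      · exfalso
        rcases h.he s hs r h1.1 hrs.symm with h' | h'
        · exact h1.2.1 h'.2
        · exact h1.2.2 h'.2
  · rintro rfl
    exact h.yS hs
  · intro h'
    rcases h.yu s hs h' with h1 | h1
    · exact hs1 h1
    · exact hs2 h1

lemma IP.three {a b c : V} (hab : G.Adj a b) (hbc : G.Adj b c) (hac : ¬ G.Adj a c) (hne : a ≠ c) :
    IP G a c {a, b, c} := by
  refine IP.cons hab (IP.cons hbc (IP.single c) ?_ ?_) ?_ ?_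
  · rintro rfl; exact G.irrefl hbc
  · rintro s rfl _; rfl
  · rintro (rfl | rfl)
    · exact G.irrefl hab
    · exact hne rfl
  · rintro s (rfl | rfl) h'
    · rfl
    · exact absurd h' hac

lemma step4A [Finite V] (hG : InC G) (h : Cfg G y x₁ x₂ t₁ t₂ S T)
    (l : Link G y x₁ x₂ q₁ q₂ S T Q) (ti : Tight G x₁ x₂ q₁ q₂ S T Q)
    (h2 : ∀ q ∈ Q, G.Adj q x₁ ∨ G.Adj q x₂ → q = q₁) (hq1 : G.Adj q₂ t₁) (hq2 : G.Adj q₂ t₂)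
    (hne : q₂ ≠ q₁) (hX : ¬ G.Adj y t₂) : False := by
  have hqm := l.hQ.right_mem
  have m1 := h.hT.left_mem
  have m2 := h.hT.right_mem
  have hP : IP G t₂ t₁ {t₂, q₂, t₁} :=
    IP.three hq2.symm hq1 (fun h' => h.nat hG h'.symm) (h.tne hG).symm
  have hedge : ∀ s ∈ S, ¬ G.Adj s q₂ := by
    intro s hs hsq
    apply hne
    by_cases e1 : s = x₁
    · subst e1; exact h2 _ hqm (Or.inl hsq.symm)
    · by_cases e2 : s = x₂
      · subst e2; exact h2 _ hqm (Or.inr hsq.symm)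
      · exact ti.uS _ hqm s hs e1 e2 hsq.symm
  have hC : HoleAt G x₂ (S ∪ {t₂, q₂, t₁}) := by
    refine HoleAt.of_two h.hS.symm hP ?_ h.e₂ h.e₁ h.ne.symm (Or.inr (h.tne hG).symm) ?_
    · rintro s hs (rfl | rfl | rfl)
      · exact h.disj _ hs m2
      · exact l.nS _ hqm hs
      · exact h.disj _ hs m1
    · rintro s hs t (rfl | rfl | rfl) hst
      · exact (h.he s hs _ m2 hst).symm
      · exact absurd hst (hedge s hs)
      · exact (h.he s hs _ m1 hst).symm
  have key : ∀ s ∈ S ∪ {t₂, q₂, t₁}, s ≠ x₂ → G.Adj y s → s = x₁ ∨ s = t₁ := by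
    rintro s (hs | rfl | rfl | rfl) hsx hys
    · exact Or.inl ((h.yu s hs hys).resolve_right hsx)
    · exact absurd hys hX
    · exact absurd hys (l.nay _ hqm)
    · exact Or.inr rfl
  refine linkW hG hC (u := y) ?_ h.y₂.symm ?_ ?_ ⟨x₁, Or.inl h.hS.left_mem, h.ne, h.y₁⟩
  · rintro (h' | rfl | rfl | rfl)
    · exact h.yS h'
    · exact h.yT m2
    · exact l.ny _ hqm rfl
    · exact h.yT m1
  · intro s hs hsx hys
    rcases key s hs hsx hys with rfl | rfl
    · exact h.symm.na
    · exact h.symm.not12 hG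
  · intro s hs hsx t ht htx hys hyt
    have := h.e₁
    have := h.e₁.symm
    rcases key s hs hsx hys with rfl | rfl <;> rcases key t ht htx hyt with rfl | rfl <;>
      first | exact Or.inl rfl | exact Or.inr (by assumption)

lemma step4a [Finite V] (hG : InC G) (h : Cfg G y x₁ x₂ t₁ t₂ S T) {q : V} (hqS : q ∉ S)
    (hqT : q ∉ T) (hqy : q ≠ y) (hyq : ¬ G.Adj y q) (h₁ : ∃ s ∈ S, s ≠ x₁ ∧ s ≠ x₂ ∧ G.Adj q s)
    (hq1 : G.Adj q t₁) (hT : ∀ t ∈ T, G.Adj q t → t = t₁ ∨ t = t₂)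
    (hqx : G.Adj q x₁) : False := by
  have m1 := h.hT.left_mem
  have m2 := h.hT.right_mem
  have n1 := h.hS.left_mem
  have n2 := h.hS.right_mem
  have hqx2 : ¬ G.Adj q x₂ := fun h' => h.ne (common hG hqy.symm hyq h.y₁ hqx h.y₂ h')
  have hyt1 : ¬ G.Adj y t₁ := by
    intro h'
    have := common hG hqy.symm hyq h.y₁ hqx h' hq1
    exact h.disj _ n1 (this ▸ m1)
  obtain ⟨s, hs, hs1, hs2, hqs⟩ := h₁
  obtain ⟨z, S₂, S₃, hSS, hd, hS₂, hz, hu, hrest⟩ := h.hS.symm.first (fun s => G.Adj q s)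
    ⟨s, hs, hqs⟩
  rcases hrest with ⟨rfl, rfl⟩ | ⟨hx1, z', hS₃, hzz, he⟩
  · rw [Set.union_empty] at hSS
    exact hs1 (hu s (hSS ▸ hs) hqs)
  have hS2 : ∀ s ∈ S₂, s ∈ S := fun s hs => hSS ▸ Or.inl hs
  have hzm := hS2 z hS₂.right_mem
  have hzx : z ≠ x₁ := fun e => hx1 (e ▸ hS₂.right_mem)
  have hzt : ¬ G.Adj z t₁ := by
    intro h'
    rcases h.he z hzm _ m1 h' with h1 | h1
    · exact hzx h1.1
    · exact h.tne hG h1.2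
  have hzx1 : ¬ G.Adj z x₁ := by
    intro h'
    exact no_diamond hG hqx hz.symm h' hq1.symm h.e₁.symm hzt
      (fun e => h.disj z hzm (e ▸ m1))
  have hx1q : x₁ ≠ q := fun e => hqS (e ▸ n1)
  have hP : IP G x₁ x₂ ({x₁, q} ∪ S₂) := by
    have hxq : IP G x₁ q {x₁, q} :=
      IP.cons hqx.symm (IP.single q) (by simpa using hx1q) (by rintro s rfl _; rfl)
    refine hxq.append hS₂.symm hz ?_ ?_
    · rintro s (rfl | rfl) h'
      · exact hx1 h'
      · exact hqS (hS2 _ h')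
    · rintro s (rfl | rfl) t ht hst
      · exfalso
        have h3 : s ∈ S₃ := hS₃.right_mem
        have := (he t ht s h3 hst.symm).1
        subst this
        exact hzx1 hst.symm
      · exact ⟨rfl, hu t ht hst⟩
  have hyP : y ∉ ({x₁, q} ∪ S₂ : Set V) := by
    rintro ((rfl | rfl) | h')
    · exact h.yS n1
    · exact hqy rfl
    · exact h.yS (hS2 _ h')
  have hC : HoleAt G y (insert y ({x₁, q} ∪ S₂)) := by
    refine ⟨Or.inl rfl, x₁, x₂, hP.congr ?_, h.ne, h.na, h.y₁, h.y₂, ?_⟩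
    · rw [Set.insert_sdiff_of_mem _ (Set.mem_singleton y), Set.sdiff_singleton_eq_self hyP]
    · rintro s (rfl | (rfl | rfl) | hs) h'
      · exact absurd h' (G.irrefl)
      · exact Or.inl rfl
      · exact absurd h' hyq
      · exact h.yu s (hS2 s hs) h'
  obtain ⟨x₃, h3, h31, h32, hy3⟩ := h.exists_x3 hG
  obtain ⟨p, r, R, hRD, hR, hp, rfl, hpu, -⟩ := h.hT.symm.conn_left.extract (fun v => G.Adj y v)
    (fun v => v = t₁) ⟨x₃, ⟨h3, h32⟩, hy3⟩ ⟨t₁, ⟨m1, h.tne hG⟩, rfl⟩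
  refine linkL hG hC hR ?_ ?_ hp hpu ?_ ⟨q, Or.inr (Or.inl (Or.inr rfl)), hqy, hq1.symm, hyq⟩
  · rintro rfl; exact hyt1 hp
  · rintro r' hr (rfl | (rfl | rfl) | h')
    · exact h.yT (hRD hr).1
    · exact h.disj _ n1 (hRD hr).1
    · exact hqT (hRD hr).1
    · exact h.disj _ (hS2 _ h') (hRD hr).1
  · have hSc : ∀ r' ∈ R, ∀ s ∈ S, G.Adj r' s → r' = r := by
      intro r' hr s hs hrs
      rcases h.he s hs r' (hRD hr).1 hrs.symm with h' | h'
      · exact h'.2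
      · exact absurd h'.2 (hRD hr).2
    rintro r' hr s (rfl | (rfl | rfl) | hs) hsy hrs
    · exact absurd rfl hsy
    · exact hSc r' hr _ n1 hrs
    · exact (hT r' (hRD hr).1 hrs.symm).resolve_right (hRD hr).2
    · exact hSc r' hr _ (hS2 s hs) hrs

lemma step4c [Finite V] (hG : InC G) (h : Cfg G y x₁ x₂ t₁ t₂ S T) {q : V} (hqS : q ∉ S)
    (hqT : q ∉ T) (hqy : q ≠ y) (hyq : ¬ G.Adj y q) (h₁ : ∃ s ∈ S, s ≠ x₁ ∧ s ≠ x₂ ∧ G.Adj q s)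
    (hq1 : G.Adj q t₁) (hq2 : G.Adj q t₂)
    (hqx1 : ¬ G.Adj q x₁) (hqx2 : ¬ G.Adj q x₂) (hX : ¬ G.Adj y t₂) : False := by
  have m1 := h.hT.left_mem
  have m2 := h.hT.right_mem
  have n1 := h.hS.left_mem
  have n2 := h.hS.right_mem
  obtain ⟨s, hs, hs1, hs2, hqs⟩ := h₁
  obtain ⟨z, S₁, S₂, hSS, hd, hS₁, hz, hu, hrest⟩ := h.hS.first (fun s => G.Adj q s)
    ⟨s, hs, hqs⟩
  rcases hrest with ⟨rfl, rfl⟩ | ⟨hx2, z', hS₂, hzz, he⟩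
  · exact hqx2 hz
  have hS1 : ∀ s ∈ S₁, s ∈ S := fun s hs => hSS ▸ Or.inl hs
  have hzm := hS1 z hS₁.right_mem
  have hzx2 : z ≠ x₂ := fun e => hx2 (e ▸ hS₁.right_mem)
  have ht2S : ∀ s ∈ S, s ≠ x₂ → ¬ G.Adj s t₂ := by
    intro s hs hsx h'
    rcases h.he s hs _ m2 h' with h1 | h1
    · exact h.tne hG h1.2.symm
    · exact hsx h1.1
  have ht1S : ∀ s ∈ S, G.Adj s t₁ → s = x₁ := by
    intro s hs h'
    rcases h.he s hs _ m1 h' with h1 | h1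
    · exact h1.1
    · exact absurd h1.2 (h.tne hG)
  have hzt : ¬ G.Adj z t₂ := ht2S z hzm hzx2
  have hzx2' : ¬ G.Adj z x₂ := by
    intro h'
    exact no_C4 hG h'.symm hz.symm hq2 h.e₂.symm (fun h1 => hqx2 h1.symm) hzt
      (fun e => hqS (e ▸ n2)) (fun e => h.disj z hzm (e ▸ m2))
  have hyt2 : y ≠ t₂ := fun e => h.yT (e ▸ m2)
  have hP : IP G z t₂ (S₁ ∪ {y, x₂, t₂}) := by
    refine hS₁.symm.append (IP.three h.y₂ h.e₂ hX hyt2) h.y₁.symm ?_ ?_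
    · rintro s hs (rfl | rfl | rfl)
      · exact h.yS (hS1 _ hs)
      · exact hx2 hs
      · exact h.disj _ (hS1 _ hs) m2
    · rintro s hs t (rfl | rfl | rfl) hst
      · refine ⟨(h.yu s (hS1 s hs) hst.symm).resolve_right ?_, rfl⟩
        rintro rfl
        exact hx2 hs
      · exfalso
        have := (he s hs _ hS₂.right_mem hst).1
        subst this
        exact hzx2' hst
      · exfalso
        refine ht2S s (hS1 s hs) ?_ hst
        rintro rfl
        exact hx2 hs
  have hqP : q ∉ S₁ ∪ {y, x₂, t₂} := by
    rintro (h' | rfl | rfl | rfl)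
    · exact hqS (hS1 _ h')
    · exact hqy rfl
    · exact hqS n2
    · exact hqT m2
  have hC : HoleAt G q (insert q (S₁ ∪ {y, x₂, t₂})) := by
    refine ⟨Or.inl rfl, z, t₂, hP.congr ?_, fun e => h.disj z hzm (e ▸ m2), hzt, hz, hq2, ?_⟩
    · rw [Set.insert_sdiff_of_mem _ (Set.mem_singleton q), Set.sdiff_singleton_eq_self hqP]
    · rintro s (rfl | hs | rfl | rfl | rfl) h'
      · exact absurd h' (G.irrefl)
      · exact Or.inl (hu s hs h')
      · exact absurd h'.symm hyq
      · exact absurd h' hqx2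
      · exact Or.inr rfl
  have key : ∀ s ∈ insert q (S₁ ∪ {y, x₂, t₂}), s ≠ q → G.Adj t₁ s → s = x₁ ∨ s = y := by
    rintro s (rfl | hs | rfl | rfl | rfl) hsq h'
    · exact absurd rfl hsq
    · exact Or.inl (ht1S s (hS1 s hs) h'.symm)
    · exact Or.inr rfl
    · exact Or.inl (ht1S _ n2 h'.symm)
    · exact absurd h' (h.nat hG)
  refine linkW hG hC (u := t₁) ?_ hq1 ?_ ?_ ⟨x₁, Or.inr (Or.inl hS₁.left_mem), ?_, h.e₁.symm⟩
  · rintro (h' | h' | h' | h' | h')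
    · exact hqT (h' ▸ m1)
    · exact h.disj _ (hS1 _ h') m1
    · exact h.yT (h' ▸ m1)
    · exact h.disj _ n2 (h' ▸ m1)
    · exact h.tne hG h'
  · intro s hs hsq h'
    rcases key s hs hsq h' with rfl | rfl
    · exact hqx1
    · exact fun h1 => hyq h1.symm
  · intro s hs hsx t ht htx hys hyt
    have := h.y₁
    have := h.y₁.symm
    rcases key s hs hsx hys with rfl | rfl <;> rcases key t ht htx hyt with rfl | rfl <;>
      first | exact Or.inl rfl | exact Or.inr (by assumption)
  · rintro rfl; exact hqS n1

lemma no_link_aux [Finite V] (hG : InC G) (n : ℕ) : ∀ {x₁ x₂ t₁ t₂ q₁ q₂ : V} {S T Q : Set V},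
    Q.ncard = n → Cfg G y x₁ x₂ t₁ t₂ S T → Link G y x₁ x₂ q₁ q₂ S T Q → False := by
  induction n using Nat.strong_induction_on with
  | _ n IH =>
  intro x₁ x₂ t₁ t₂ q₁ q₂ S T Q hn h l
  have ih : ∀ {a₁ a₂ b₁ b₂ r₁ r₂ : V} {A B R : Set V}, R.ncard < Q.ncard →
      Cfg G y a₁ a₂ b₁ b₂ A B → Link G y a₁ a₂ r₁ r₂ A B R → False :=
    fun hlt => IH _ (hn ▸ hlt) rfl
  have hlt : ∀ {a b c : V} {A B : Set V}, Q = A ∪ B → (∀ s ∈ A, s ∉ B) → IP G a b B →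
      A.ncard < Q.ncard := by
    rintro a b c A B rfl hd hB
    apply Set.ncard_lt_ncard _ (Set.toFinite _)
    refine ⟨Set.subset_union_left, fun h' => ?_⟩
    exact hd a (h' (Or.inr hB.left_mem)) hB.left_mem
  have ti : Tight G x₁ x₂ q₁ q₂ S T Q := by
    constructor
    · intro q hq s hs hs1 hs2 hqs
      obtain ⟨z, A, B, e, hd, hA, hz, hu, hrest⟩ :=
        l.hQ.symm.first (fun q => ∃ s ∈ S, s ≠ x₁ ∧ s ≠ x₂ ∧ G.Adj q s)
          ⟨q, hq, s, hs, hs1, hs2, hqs⟩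
      rcases hrest with ⟨rfl, rfl⟩ | ⟨_, z', hB, -, -⟩
      · rw [Set.union_empty] at e
        exact hu q (e ▸ hq) ⟨s, hs, hs1, hs2, hqs⟩
      · exfalso
        have hAQ : ∀ q ∈ A, q ∈ Q := fun q hq => e ▸ Or.inl hq
        refine ih (hlt (c := q) e hd hB) h ⟨hA.symm, fun q hq => l.nS q (hAQ q hq),
          fun q hq => l.nT q (hAQ q hq), fun q hq => l.ny q (hAQ q hq),
          fun q hq => l.nay q (hAQ q hq), hz, l.h₂⟩
    · intro q hq t ht hqt
      obtain ⟨z, A, B, e, hd, hA, hz, hu, hrest⟩ :=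
        l.hQ.first (fun q => ∃ s ∈ T, G.Adj q s) ⟨q, hq, t, ht, hqt⟩
      rcases hrest with ⟨rfl, rfl⟩ | ⟨_, z', hB, -, -⟩
      · rw [Set.union_empty] at e
        exact hu q (e ▸ hq) ⟨t, ht, hqt⟩
      · exfalso
        have hAQ : ∀ q ∈ A, q ∈ Q := fun q hq => e ▸ Or.inl hq
        refine ih (hlt (c := q) e hd hB) h ⟨hA, fun q hq => l.nS q (hAQ q hq),
          fun q hq => l.nT q (hAQ q hq), fun q hq => l.ny q (hAQ q hq),
          fun q hq => l.nay q (hAQ q hq), l.h₁, hz⟩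
  have h2 := step2 hG h l ti ih
  have hT : ∀ t ∈ T, G.Adj q₂ t → t = t₁ ∨ t = t₂ := by
    intro t ht hqt
    by_contra h'
    push Not at h'
    exact step3 hG h l ti h2 ht h'.1 h'.2 hqt
  have hq2 : G.Adj q₂ t₂ := by
    obtain ⟨t, ht, hqt, hne⟩ := step1 hG h l ti
    have := (hT t ht hqt).resolve_left hne
    rwa [this] at hqt
  have hq1 : G.Adj q₂ t₁ := by
    obtain ⟨t, ht, hqt, hne⟩ := step1 hG h.symm l.symm ti.symm
    have := (hT t ht hqt).resolve_right hne
    rwa [this] at hqt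
  have hqm := l.hQ.right_mem
  have hX : ¬ G.Adj y t₂ ∨ ¬ G.Adj y t₁ := by
    by_contra h'
    push Not at h'
    exact h.tne hG (common hG (l.ny _ hqm).symm (l.nay _ hqm) h'.2 hq1 h'.1 hq2)
  by_cases hne : q₂ = q₁
  · have a1 := l.nS _ hqm
    have a2 := l.nT _ hqm
    have a3 := l.ny _ hqm
    have a4 := l.nay _ hqm
    have a5 := l.h₁
    rw [← hne] at a5
    have a6 := l.symm.h₁
    rw [← hne] at a6
    by_cases hx1 : G.Adj q₂ x₁
    · exact step4a hG h a1 a2 a3 a4 a5 hq1 hT hx1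
    by_cases hx2 : G.Adj q₂ x₂
    · exact step4a hG h.symm a1 a2 a3 a4 a6 hq2 (fun t ht h' => (hT t ht h').symm) hx2
    rcases hX with hX | hX
    · exact step4c hG h a1 a2 a3 a4 a5 hq1 hq2 hx1 hx2 hX
    · exact step4c hG h.symm a1 a2 a3 a4 a6 hq2 hq1 hx2 hx1 hX
  · rcases hX with hX | hX
    · exact step4A hG h l ti h2 hq1 hq2 hne hX
    · exact step4A hG h.symm l.symm ti.symm (fun q hq h' => h2 q hq h'.symm) hq2 hq1 hne hX

lemma no_link [Finite V] (hG : InC G) (h : Cfg G y x₁ x₂ t₁ t₂ S T)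
    (l : Link G y x₁ x₂ q₁ q₂ S T Q) : False := no_link_aux hG _ rfl h l

lemma Cfg.not_conn [Finite V] (hG : InC G) (h : Cfg G y x₁ x₂ t₁ t₂ S T) {W : Set V}
    (hSW : S ⊆ W) (hTW : T ⊆ W) : ¬ Conn G {w | w ∈ W ∧ w ≠ y ∧ ¬ G.Adj y w} := by
  intro hconn
  have m1 := h.hT.left_mem
  have n1 := h.hS.left_mem
  have hSn : ∃ a ∈ {w | w ∈ W ∧ w ≠ y ∧ ¬ G.Adj y w}, a ∈ S := by
    obtain ⟨c, hc, hxc, -⟩ := h.hS.tail h.ne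
    have hcS := hc.left_mem
    refine ⟨c, ⟨hSW hcS.1, ?_, fun h' => ?_⟩, hcS.1⟩
    · rintro rfl; exact h.yS hcS.1
    · rcases h.yu c hcS.1 h' with rfl | rfl
      · exact hcS.2 rfl
      · exact h.na hxc
  have hTn : ∃ a ∈ {w | w ∈ W ∧ w ≠ y ∧ ¬ G.Adj y w}, a ∈ T := by
    by_cases hyt : G.Adj y t₁
    · obtain ⟨c, hc, hxc, -⟩ := h.hT.tail (h.tne hG)
      have hcT := hc.left_mem
      refine ⟨c, ⟨hTW hcT.1, ?_, fun h' => ?_⟩, hcT.1⟩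
      · rintro rfl; exact h.yT hcT.1
      · refine no_diamond hG hyt h.y₁.symm h.e₁ h'.symm hxc.symm ?_ ?_
        · intro h1
          rcases h.he _ n1 _ hcT.1 h1 with h2 | h2
          · exact hcT.2 h2.2
          · exact h.ne h2.1
        · rintro rfl
          exact h.disj _ n1 hcT.1
    · refine ⟨t₁, ⟨hTW m1, ?_, hyt⟩, m1⟩
      rintro rfl; exact h.yT m1
  obtain ⟨p, q, R, hRD, hR, hp, hq, hpu, hqu⟩ :=
    hconn.extract (fun v => v ∈ S) (fun v => v ∈ T) hSn hTn
  have hRD' : ∀ r ∈ R, r ≠ y ∧ ¬ G.Adj y r := fun r hr => (hRD hr).2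
  have hpq : p ≠ q := by rintro rfl; exact h.disj p hp hq
  have hpy := (hRD' p hR.left_mem).2
  have hp1 : p ≠ x₁ := by rintro rfl; exact hpy h.y₁
  have hp2 : p ≠ x₂ := by rintro rfl; exact hpy h.y₂
  have hpq' : ¬ G.Adj p q := by
    intro h'
    rcases h.he p hp q hq h' with h1 | h1
    · exact hp1 h1.1
    · exact hp2 h1.1
  obtain ⟨c, hc, hpc, -⟩ := hR.tail hpq
  have hcq : q ≠ c := by rintro rfl; exact hpq' hpc
  obtain ⟨c', hc', hqc, -⟩ := hc.symm.tail hcq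
  refine no_link hG h (q₁ := c) (q₂ := c') ⟨hc'.symm, ?_, ?_, ?_, ?_, ⟨p, hp, hp1, hp2, hpc.symm⟩,
    ⟨q, hq, hqc.symm⟩⟩
  · intro s hs h'
    exact hs.1.2 (hpu s hs.1.1 h')
  · intro s hs h'
    exact hs.2 (hqu s hs.1.1 h')
  · intro s hs
    exact (hRD' s hs.1.1).1
  · intro s hs
    exact (hRD' s hs.1.1).2

end WheelLemma

/-! ### Three independent neighbors attached to a connected set -/

section Tool
variable {G : SimpleGraph V}

/-- Some `Cfg` with center `y` lives inside `W`. -/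
def HasCfg (G : SimpleGraph V) (y : V) (W : Set V) : Prop :=
  ∃ x₁ x₂ t₁ t₂ S T, Cfg G y x₁ x₂ t₁ t₂ S T ∧ S ⊆ W ∧ T ⊆ W

lemma HasCfg.mono {y : V} {W W' : Set V} (h : HasCfg G y W) (hW : W ⊆ W') : HasCfg G y W' := by
  obtain ⟨x₁, x₂, t₁, t₂, S, T, h, a, b⟩ := h
  exact ⟨x₁, x₂, t₁, t₂, S, T, h, a.trans hW, b.trans hW⟩

lemma hub {v y₁ y₂ y₃ : V} {P : Set V} (hP : IP G y₁ y₂ P) (hvP : v ∉ P) (h1 : G.Adj v y₁)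
    (h2 : G.Adj v y₂) (hvu : ∀ s ∈ P, G.Adj v s → s = y₁ ∨ s = y₂)
    (h3 : G.Adj v y₃) (h3P : y₃ ∉ P) (h31 : ¬ G.Adj y₃ y₁) (h32 : ¬ G.Adj y₃ y₂)
    (hn : ∃ s ∈ P, G.Adj y₃ s) : HasCfg G y₃ (insert v P) := by
  obtain ⟨a, S₁, S₂, rfl, hd, hS₁, ha, hu, hrest⟩ := hP.first (fun s => G.Adj y₃ s) hn
  rcases hrest with ⟨rfl, rfl⟩ | ⟨hy2, a', hS₂, haa, he⟩
  · exact absurd ha h32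
  have m1 := hS₁.left_mem
  have m2 := hS₁.right_mem
  refine ⟨v, a, y₂, a', insert v S₁, S₂, ⟨IP.cons h1 hS₁ (fun h => hvP (Or.inl h)) ?_, hS₂.symm,
    ?_, h2, haa, ?_, ?_, fun h => h3P (Or.inr h), h3.symm, ha, ?_, ?_, ?_⟩, ?_, ?_⟩
  · intro s hs hvs
    refine (hvu s (Or.inl hs) hvs).resolve_right ?_
    rintro rfl
    exact hy2 hs
  · rintro s (rfl | hs) h'
    · exact hvP (Or.inr h')
    · exact hd s hs h'
  · rintro s (rfl | hs) t ht hst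
    · left
      refine ⟨rfl, (hvu t (Or.inr ht) hst).resolve_left ?_⟩
      rintro rfl
      exact hd _ m1 ht
    · exact Or.inr (he s hs t ht hst)
  · rintro (rfl | h)
    · exact G.irrefl h3
    · exact h3P (Or.inl h)
  · rintro s (rfl | hs) h
    · exact Or.inl rfl
    · exact Or.inr (hu s hs h)
  · rintro rfl
    exact hvP (Or.inl m2)
  · intro h
    rcases hvu a (Or.inl m2) h with rfl | rfl
    · exact h31 ha
    · exact h32 ha
  · exact Set.insert_subset_insert Set.subset_union_left
  · exact fun s hs => Or.inr (Or.inr hs)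

lemma tool_core (hG : InC G) {v y₁ y₂ y₃ : V} {D : Set V} (a1 : G.Adj v y₁) (a2 : G.Adj v y₂)
    (a3 : G.Adj v y₃) (n12 : ¬ G.Adj y₁ y₂) (n13 : ¬ G.Adj y₁ y₃) (n23 : ¬ G.Adj y₂ y₃)
    (d12 : y₁ ≠ y₂) (d13 : y₁ ≠ y₃) (d23 : y₂ ≠ y₃) (hvD : ∀ d ∈ D, d ≠ v ∧ ¬ G.Adj v d)
    {w₁ wj z' wl : V} {W₁ W₂ P : Set V} (hW₁ : IP G w₁ wj W₁) (hW₂ : IP G z' wl W₂)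
    (hwz : G.Adj wj z') (hd : ∀ s ∈ W₁, s ∉ W₂)
    (he : ∀ s ∈ W₁, ∀ t ∈ W₂, G.Adj s t → s = wj ∧ t = z') (hW₁D : W₁ ⊆ D) (hW₂D : W₂ ⊆ D)
    (hPD : P ⊆ D) (hPc : Conn G P) (hWP : ∀ w ∈ W₁, w ∉ P ∧ ∀ u ∈ P, ¬ G.Adj w u)
    (hlP : ∃ u ∈ P, G.Adj wl u) (hy3 : G.Adj y₃ w₁) (hy3W : ∀ s ∈ W₁, G.Adj y₃ s → s = w₁)
    (hy3W₂ : ∀ s ∈ W₂, ¬ G.Adj y₃ s) (hy3P : ∀ s ∈ P, ¬ G.Adj y₃ s) (hy1 : G.Adj y₁ wj)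
    (hy2 : ∀ s ∈ W₁, G.Adj y₂ s → s = wj) (hq : ∃ q ∈ P, G.Adj y₂ q) :
    HasCfg G y₁ ({v, y₁, y₂, y₃} ∪ D) := by
  have ny1 : y₁ ∉ D := fun h => (hvD _ h).2 a1
  have ny2 : y₂ ∉ D := fun h => (hvD _ h).2 a2
  have ny3 : y₃ ∉ D := fun h => (hvD _ h).2 a3
  have nv : v ∉ D := fun h => (hvD _ h).1 rfl
  have hwj := hvD wj (hW₁D hW₁.right_mem)
  have hwj2 : ¬ G.Adj y₂ wj := fun h => d12 (common hG hwj.1.symm hwj.2 a1 hy1.symm a2 h.symm)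
  obtain ⟨u, hu, hlu⟩ := hlP
  obtain ⟨q, hq, hyq⟩ := hq
  have hZ : Conn G (W₂ ∪ P) := hW₂.conn.union hPc hW₂.right_mem hu hlu
  obtain ⟨z₁, z₂, Z, hZs, hZp, hz₁, hz₂, hz₁u, hz₂u⟩ := hZ.extract (fun s => G.Adj wj s)
    (fun s => G.Adj y₂ s) ⟨z', Or.inl hW₂.left_mem, hwz⟩ ⟨q, Or.inr hq, hyq⟩
  have hZD : ∀ z ∈ Z, z ∈ D := by
    intro z hz
    rcases hZs hz with h | h
    · exact hW₂D h
    · exact hPD h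
  have h3Z : ∀ z ∈ Z, ¬ G.Adj y₃ z := by
    intro z hz
    rcases hZs hz with h | h
    · exact hy3W₂ z h
    · exact hy3P z h
  have hA : IP G y₃ wj (insert y₃ W₁) :=
    IP.cons hy3 hW₁ (fun h => ny3 (hW₁D h)) hy3W
  have hB : IP G y₃ z₂ (insert y₃ W₁ ∪ Z) := by
    refine hA.append hZp hz₁ ?_ ?_
    · rintro s (rfl | hs) h
      · exact ny3 (hZD _ h)
      · rcases hZs h with h' | h'
        · exact hd s hs h'
        · exact (hWP s hs).1 h'
    · rintro s (rfl | hs) t ht hst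
      · exact absurd hst (h3Z t ht)
      · have : s = wj := by
          rcases hZs ht with h' | h'
          · exact (he s hs t h' hst).1
          · exact absurd hst ((hWP s hs).2 t h')
        subst this
        exact ⟨rfl, hz₁u t ht hst⟩
  have hC : IP G y₃ y₂ (insert y₃ W₁ ∪ Z ∪ {y₂}) := by
    refine hB.append (IP.single y₂) hz₂.symm ?_ ?_
    · rintro s ((rfl | hs) | hs) h
      · exact d23 (Eq.symm h)
      · rw [Set.mem_singleton_iff] at h
        subst h
        exact ny2 (hW₁D hs)
      · rw [Set.mem_singleton_iff] at h
        subst h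
        exact ny2 (hZD _ hs)
    · rintro s hs t rfl hst
      refine ⟨?_, rfl⟩
      rcases hs with (rfl | hs) | hs
      · exact absurd hst.symm n23
      · have := hy2 s hs hst.symm
        subst this
        exact absurd hst.symm hwj2
      · exact hz₂u s hs hst.symm
  have hmem : ∀ s ∈ insert y₃ W₁ ∪ Z ∪ {y₂}, s = y₃ ∨ s = y₂ ∨ s ∈ D := by
    rintro s (((rfl | hs) | hs) | rfl)
    · exact Or.inl rfl
    · exact Or.inr (Or.inr (hW₁D hs))
    · exact Or.inr (Or.inr (hZD s hs))
    · exact Or.inr (Or.inl rfl)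
  refine (hub (v := v) (y₃ := y₁) hC ?_ a3 a2 ?_ a1 ?_ n13 n12
    ⟨wj, Or.inl (Or.inl (Or.inr hW₁.right_mem)), hy1⟩).mono ?_
  · intro h
    rcases hmem v h with rfl | rfl | h
    · exact G.irrefl a3
    · exact G.irrefl a2
    · exact nv h
  · intro s hs hvs
    rcases hmem s hs with h | h | h
    · exact Or.inl h
    · exact Or.inr h
    · exact absurd hvs (hvD s h).2
  · intro h
    rcases hmem _ h with h | h | h
    · exact d13 h
    · exact d12 h
    · exact ny1 h
  · rintro s (rfl | hs)
    · exact Or.inl (Or.inl rfl)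
    · rcases hmem s hs with rfl | rfl | h
      · simp
      · simp
      · exact Or.inr h

lemma tool (hG : InC G) {v y₁ y₂ y₃ : V} {D : Set V} (a1 : G.Adj v y₁) (a2 : G.Adj v y₂)
    (a3 : G.Adj v y₃) (n12 : ¬ G.Adj y₁ y₂) (n13 : ¬ G.Adj y₁ y₃) (n23 : ¬ G.Adj y₂ y₃)
    (d12 : y₁ ≠ y₂) (d13 : y₁ ≠ y₃) (d23 : y₂ ≠ y₃) (hD : Conn G D)
    (hvD : ∀ d ∈ D, d ≠ v ∧ ¬ G.Adj v d) (e1 : ∃ d ∈ D, G.Adj y₁ d) (e2 : ∃ d ∈ D, G.Adj y₂ d)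
    (e3 : ∃ d ∈ D, G.Adj y₃ d) :
    ∃ y, (y = y₁ ∨ y = y₂ ∨ y = y₃) ∧ HasCfg G y ({v, y₁, y₂, y₃} ∪ D) := by
  have ny1 : y₁ ∉ D := fun h => (hvD _ h).2 a1
  have ny2 : y₂ ∉ D := fun h => (hvD _ h).2 a2
  have ny3 : y₃ ∉ D := fun h => (hvD _ h).2 a3
  have nv : v ∉ D := fun h => (hvD _ h).1 rfl
  obtain ⟨p, q, P, hPD, hP, hp, hq, hpu, hqu⟩ := hD.extract (fun s => G.Adj y₁ s)
    (fun s => G.Adj y₂ s) e1 e2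
  have hP' : IP G y₁ y₂ (insert y₁ P ∪ {y₂}) := by
    have h := IP.cons hp hP (fun h => ny1 (hPD h)) hpu
    refine h.append (IP.single y₂) hq.symm ?_ ?_
    · rintro s (rfl | hs) h'
      · exact d12 h'
      · rw [Set.mem_singleton_iff] at h'
        subst h'
        exact ny2 (hPD hs)
    · rintro s (rfl | hs) t rfl hst
      · exact absurd hst n12
      · exact ⟨hqu s hs hst.symm, rfl⟩
  have hmem : ∀ s ∈ insert y₁ P ∪ {y₂}, s = y₁ ∨ s = y₂ ∨ s ∈ P := by
    rintro s ((rfl | hs) | rfl)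
    · exact Or.inl rfl
    · exact Or.inr (Or.inr hs)
    · exact Or.inr (Or.inl rfl)
  have hvP' : v ∉ insert y₁ P ∪ {y₂} := by
    intro h
    rcases hmem v h with rfl | rfl | h
    · exact G.irrefl a1
    · exact G.irrefl a2
    · exact nv (hPD h)
  have hvP'u : ∀ s ∈ insert y₁ P ∪ {y₂}, G.Adj v s → s = y₁ ∨ s = y₂ := by
    intro s hs hvs
    rcases hmem s hs with h | h | h
    · exact Or.inl h
    · exact Or.inr h
    · exact absurd hvs (hvD s (hPD h)).2
  have h3P' : y₃ ∉ insert y₁ P ∪ {y₂} := by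
    intro h
    rcases hmem _ h with h | h | h
    · exact d13 h.symm
    · exact d23 h.symm
    · exact ny3 (hPD h)
  by_cases hy3P : ∃ s ∈ P, G.Adj y₃ s
  · refine ⟨y₃, Or.inr (Or.inr rfl), ?_⟩
    obtain ⟨s, hs, hys⟩ := hy3P
    refine (hub hP' hvP' a1 a2 hvP'u a3 h3P' (fun h => n13 h.symm) (fun h => n23 h.symm)
      ⟨s, Or.inl (Or.inr hs), hys⟩).mono ?_
    rintro s (rfl | hs)
    · exact Or.inl (Or.inl rfl)
    · rcases hmem s hs with rfl | rfl | h
      · simp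
      · simp
      · exact Or.inr (hPD h)
  have hy3P' : ∀ s ∈ P, ¬ G.Adj y₃ s := fun s hs h => hy3P ⟨s, hs, h⟩
  obtain ⟨w₁, wl, W, hWD, hW, hw₁, hwl, hw₁u, hwlu⟩ := hD.extract (fun s => G.Adj y₃ s)
    (fun s => s ∈ P ∨ ∃ u ∈ P, G.Adj s u) e3 ⟨p, hPD hP.left_mem, Or.inl hP.left_mem⟩
  have hwlP : wl ∉ P := by
    intro h
    have hne : wl ≠ w₁ := by
      rintro rfl
      exact hy3P' _ h hw₁
    obtain ⟨c, hc, hwc, -⟩ := hW.symm.tail hne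
    exact hc.left_mem.2 (hwlu c hc.left_mem.1 (Or.inr ⟨wl, h, hwc.symm⟩))
  have hWP : ∀ w ∈ W, w ∉ P := by
    intro w hw h
    have := hwlu w hw (Or.inl h)
    exact hwlP (this ▸ h)
  have hWPa : ∀ w ∈ W, ∀ u ∈ P, G.Adj w u → w = wl := fun w hw u hu h =>
    hwlu w hw (Or.inr ⟨u, hu, h⟩)
  have hlu : ∃ u ∈ P, G.Adj wl u := hwl.resolve_left hwlP
  by_cases hcase : ∃ w ∈ W, w ≠ wl ∧ (G.Adj y₁ w ∨ G.Adj y₂ w)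
  · obtain ⟨w, hw, hwne, hyw⟩ := hcase
    obtain ⟨wj, W₁, W₂, rfl, hd, hW₁, hwj, hwju, hrest⟩ :=
      hW.first (fun s => G.Adj y₁ s ∨ G.Adj y₂ s) ⟨w, hw, hyw⟩
    rcases hrest with ⟨rfl, rfl⟩ | ⟨hl, z', hW₂, hwz, he⟩
    · exact absurd (hwju w (by simpa using hw) hyw) hwne
    have b1 : W₁ ⊆ D := fun s hs => hWD (Or.inl hs)
    have b2 : W₂ ⊆ D := fun s hs => hWD (Or.inr hs)
    have b3 : ∀ w ∈ W₁, w ∉ P ∧ ∀ u ∈ P, ¬ G.Adj w u := by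
      intro w hw
      refine ⟨hWP w (Or.inl hw), fun u hu h => ?_⟩
      have := hWPa w (Or.inl hw) u hu h
      exact hl (this ▸ hw)
    have b4 : ∀ s ∈ W₂, ¬ G.Adj y₃ s := by
      intro s hs h
      have := hw₁u s (Or.inr hs) h
      exact hd _ hW₁.left_mem (this ▸ hs)
    have b5 : ∀ s ∈ W₁, G.Adj y₃ s → s = w₁ := fun s hs => hw₁u s (Or.inl hs)
    rcases hwj with hwj | hwj
    · exact ⟨y₁, Or.inl rfl, tool_core hG a1 a2 a3 n12 n13 n23 d12 d13 d23 hvD hW₁ hW₂ hwz hd he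
        b1 b2 hPD hP.conn b3 hlu hw₁ b5 b4 hy3P' hwj (fun s hs h => hwju s hs (Or.inr h))
        ⟨q, hP.right_mem, hq⟩⟩
    · refine ⟨y₂, Or.inr (Or.inl rfl), (tool_core hG a2 a1 a3 (fun h => n12 h.symm) n23 n13 d12.symm
        d23 d13 hvD hW₁ hW₂ hwz hd he b1 b2 hPD hP.conn b3 hlu hw₁ b5 b4 hy3P' hwj
        (fun s hs h => hwju s hs (Or.inl h)) ⟨p, hP.left_mem, hp⟩).mono ?_⟩
      apply Set.union_subset_union_left
      intro s
      simp only [Set.mem_insert_iff, Set.mem_singleton_iff]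
      tauto
  · exfalso
    have hC : HoleAt G v (insert v (insert y₁ P ∪ {y₂})) := by
      refine ⟨Or.inl rfl, y₁, y₂, hP'.congr ?_, d12, n12, a1, a2, ?_⟩
      · rw [Set.insert_sdiff_of_mem _ (Set.mem_singleton v), Set.sdiff_singleton_eq_self hvP']
      · rintro s (rfl | hs) h'
        · exact absurd h' (G.irrefl)
        · exact hvP'u s hs h'
    have hR : IP G y₃ wl (insert y₃ W) := IP.cons hw₁ hW (fun h => ny3 (hWD h)) hw₁u
    obtain ⟨u, hu, hlu⟩ := hlu
    refine linkL hG hC hR ?_ ?_ a3 ?_ ?_ ⟨u, Or.inr (Or.inl (Or.inr hu)), ?_, hlu, ?_⟩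
    · rintro rfl
      exact ny3 (hWD hW.right_mem)
    · rintro r (rfl | hr) (h | h)
      · subst h; exact G.irrefl a3
      · exact h3P' h
      · subst h; exact nv (hWD hr)
      · rcases hmem r h with rfl | rfl | h
        · exact ny1 (hWD hr)
        · exact ny2 (hWD hr)
        · exact hWP r hr h
    · rintro r (rfl | hr) h
      · rfl
      · exact absurd h (hvD r (hWD hr)).2
    · rintro r (rfl | hr) s (rfl | hs) hsv hrs
      · exact absurd rfl hsv
      · exfalso
        rcases hmem s hs with rfl | rfl | h
        · exact n13 hrs.symm
        · exact n23 hrs.symm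
        · exact hy3P' s h hrs
      · exact absurd rfl hsv
      · by_contra hne
        rcases hmem s hs with rfl | rfl | h
        · exact hcase ⟨r, hr, hne, Or.inl hrs.symm⟩
        · exact hcase ⟨r, hr, hne, Or.inr hrs.symm⟩
        · exact hne (hWPa r hr s h hrs)
    · exact (hvD u (hPD hu)).1
    · exact (hvD u (hPD hu)).2

end Tool

/-! ### The main induction -/

section Main
variable {G : SimpleGraph V}

/-- The neighborhood of `v` in `W` has no four pairwise nonadjacent vertices. -/
def NoFour (G : SimpleGraph V) (W : Set V) (v : V) : Prop :=
  ∀ a ∈ W, ∀ b ∈ W, ∀ c ∈ W, ∀ d ∈ W, G.Adj v a → G.Adj v b → G.Adj v c → G.Adj v d →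
    a ≠ b → a ≠ c → a ≠ d → b ≠ c → b ≠ d → c ≠ d →
    ¬ G.Adj a b → ¬ G.Adj a c → ¬ G.Adj a d → ¬ G.Adj b c → ¬ G.Adj b d → ¬ G.Adj c d → False

/-- The vertices of `W` outside the closed neighborhood of `y`. -/
def Far (G : SimpleGraph V) (W : Set V) (y : V) : Set V := {w | w ∈ W ∧ w ≠ y ∧ ¬ G.Adj y w}

lemma main_three [Finite V] (hG : InC G) {W : Set V} {x v y₁ y₂ y₃ : V}
    (hcon : ∀ v ∈ W, v ≠ x → ¬ G.Adj x v → ¬ NoFour G W v)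
    (hconn : ∀ y ∈ W, ¬ G.Adj x y → Conn G (Far G W y))
    (hv : v ∈ W) (hxv : ¬ G.Adj x v) (h1 : y₁ ∈ W) (h2 : y₂ ∈ W) (h3 : y₃ ∈ W)
    (a1 : G.Adj v y₁) (a2 : G.Adj v y₂) (a3 : G.Adj v y₃)
    (n12 : ¬ G.Adj y₁ y₂) (n13 : ¬ G.Adj y₁ y₃) (n23 : ¬ G.Adj y₂ y₃)
    (d12 : y₁ ≠ y₂) (d13 : y₁ ≠ y₃) (d23 : y₂ ≠ y₃)
    (x1 : ¬ G.Adj x y₁) (x2 : ¬ G.Adj x y₂) (x3 : ¬ G.Adj x y₃) : False := by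
  have key : ∀ y ∈ W, G.Adj v y → ¬ G.Adj x y → ∃ d ∈ Far G W v, G.Adj y d := by
    intro y hy hvy hxy
    by_contra hno
    refine hcon y hy ?_ hxy ?_
    · rintro rfl
      exact hxv hvy.symm
    · have two : ∀ p ∈ W, ∀ q ∈ W, G.Adj y p → G.Adj y q → p ≠ v → q ≠ v → p ≠ q →
          ¬ G.Adj p q → False := by
        intro p hp q hq hyp hyq hpv hqv hpq hpq'
        have hvp : G.Adj v p := by
          by_contra h
          exact hno ⟨p, ⟨hp, hpv, h⟩, hyp⟩
        have hvq : G.Adj v q := by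
          by_contra h
          exact hno ⟨q, ⟨hq, hqv, h⟩, hyq⟩
        exact no_diamond hG hvy hvp.symm hyp.symm hvq.symm hyq.symm hpq' hpq
      intro a ha b hb c hc d _ ya yb yc _ ab ac _ bc _ _ nab nac _ nbc _ _
      by_cases e1 : a = v
      · subst e1
        exact two b hb c hc yb yc ab.symm ac.symm bc nbc
      · by_cases e2 : b = v
        · subst e2
          exact two a ha c hc ya yc e1 bc.symm ac nac
        · exact two a ha b hb ya yb e1 e2 ab nab
  obtain ⟨y, hy, x₁, x₂, t₁, t₂, S, T, hc, hS, hT⟩ := tool hG a1 a2 a3 n12 n13 n23 d12 d13 d23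
    (hconn v hv hxv) (fun d hd => hd.2) (key _ h1 a1 x1) (key _ h2 a2 x2) (key _ h3 a3 x3)
  have hsub : ({v, y₁, y₂, y₃} ∪ Far G W v : Set V) ⊆ W := by
    rintro s ((rfl | rfl | rfl | rfl) | hs)
    · exact hv
    · exact h1
    · exact h2
    · exact h3
    · exact hs.1
  have hyW : y ∈ W ∧ ¬ G.Adj x y := by
    rcases hy with rfl | rfl | rfl
    · exact ⟨h1, x1⟩
    · exact ⟨h2, x2⟩
    · exact ⟨h3, x3⟩
  exact hc.not_conn hG (hS.trans hsub) (hT.trans hsub) (hconn y hyW.1 hyW.2)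

lemma reach_mem {D : Set V} {a b : V} (ha : a ∈ D)
    (h : Relation.ReflTransGen (fun u w => u ∈ D ∧ w ∈ D ∧ G.Adj u w) a b) : b ∈ D := by
  cases h with
  | refl => exact ha
  | tail _ h => exact h.2.1

lemma reach_symm {D : Set V} {a b : V}
    (h : Relation.ReflTransGen (fun u w => u ∈ D ∧ w ∈ D ∧ G.Adj u w) a b) :
    Relation.ReflTransGen (fun u w => u ∈ D ∧ w ∈ D ∧ G.Adj u w) b a := by
  induction h with
  | refl => exact Relation.ReflTransGen.refl
  | tail _ h ih => exact Relation.ReflTransGen.head ⟨h.2.1, h.1, h.2.2.symm⟩ ih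

lemma main_aux [Finite V] (hG : InC G) (n : ℕ) : ∀ W : Set V, W.ncard = n → ∀ x ∈ W,
    (∃ u ∈ W, u ≠ x ∧ ¬ G.Adj x u) → ∃ v ∈ W, v ≠ x ∧ ¬ G.Adj x v ∧ NoFour G W v := by
  induction n using Nat.strong_induction_on with
  | _ n IH =>
  intro W hn x hx hu
  by_cases hconn : ∀ y ∈ W, ¬ G.Adj x y → Conn G (Far G W y)
  · by_contra hno
    have hcon : ∀ v ∈ W, v ≠ x → ¬ G.Adj x v → ¬ NoFour G W v := fun v a b c d =>
      hno ⟨v, a, b, c, d⟩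
    obtain ⟨v, hv, hvx, hxv⟩ := hu
    refine hcon v hv hvx hxv ?_
    intro a ha b hb c hc d hd va vb vc vd ab ac ad bc bd cd nab nac nad nbc nbd ncd
    have three := @main_three V G _ hG W x v
    have cm : ∀ {p q : V}, G.Adj v p → G.Adj v q → p ≠ q → G.Adj x p → ¬ G.Adj x q :=
      fun h1 h2 hne h3 h4 => hne (common hG hvx (fun h => hxv h.symm) h1 h3 h2 h4)
    by_cases xa : G.Adj x a
    · exact three hcon hconn hv hxv hb hc hd vb vc vd nbc nbd ncd bc bd cd
        (cm va vb ab xa) (cm va vc ac xa) (cm va vd ad xa)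
    by_cases xb : G.Adj x b
    · exact three hcon hconn hv hxv ha hc hd va vc vd nac nad ncd ac ad cd
        xa (cm vb vc bc xb) (cm vb vd bd xb)
    by_cases xc : G.Adj x c
    · exact three hcon hconn hv hxv ha hb hd va vb vd nab nad nbd ab ad bd
        xa xb (cm vc vd cd xc)
    · exact three hcon hconn hv hxv ha hb hc va vb vc nab nac nbc ab ac bc xa xb xc
  · push Not at hconn
    obtain ⟨y, hy, hxy, hnc⟩ := hconn
    have hex : ∃ a ∈ Far G W y, ∃ b ∈ Far G W y,
        ¬ Relation.ReflTransGen (fun u w => u ∈ Far G W y ∧ w ∈ Far G W y ∧ G.Adj u w) a b ∧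
        ¬ Relation.ReflTransGen (fun u w => u ∈ Far G W y ∧ w ∈ Far G W y ∧ G.Adj u w) a x := by
      unfold Conn at hnc
      push Not at hnc
      obtain ⟨a, ha, b, hb, hab⟩ := hnc
      by_cases hyx : y = x
      · subst hyx
        exact ⟨a, ha, b, hb, hab, fun h => (reach_mem ha h).2.1 rfl⟩
      · have hxF : x ∈ Far G W y := ⟨hx, fun e => hyx e.symm, fun h => hxy h.symm⟩
        by_cases hax : Relation.ReflTransGen
            (fun u w => u ∈ Far G W y ∧ w ∈ Far G W y ∧ G.Adj u w) a x
        · refine ⟨b, hb, x, hxF, ?_, ?_⟩ <;>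
          exact fun h => hab (hax.trans (reach_symm h))
        · exact ⟨a, ha, x, hxF, hax, hax⟩
    obtain ⟨a, ha, b, hb, hab, hax⟩ := hex
    set F : Set V := {w | Relation.ReflTransGen
      (fun u w => u ∈ Far G W y ∧ w ∈ Far G W y ∧ G.Adj u w) a w} with hF
    have hFD : ∀ f ∈ F, f ∈ Far G W y := fun f hf => reach_mem ha hf
    have hFc : ∀ f ∈ F, ∀ w ∈ Far G W y, G.Adj f w → w ∈ F := fun f hf w hw h =>
      Relation.ReflTransGen.tail hf ⟨hFD f hf, hw, h⟩
    have haF : a ∈ F := Relation.ReflTransGen.refl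
    set W' : Set V := {w | w ∈ W ∧ (w = y ∨ w ∈ F ∨ ∃ f ∈ F, G.Adj f w)} with hW'
    have hbW' : b ∉ W' := by
      rintro ⟨-, h | h | ⟨f, hf, h⟩⟩
      · exact hb.2.1 h
      · exact hab h
      · exact hab (hFc f hf b hb h)
    have hlt : W'.ncard < n := by
      rw [← hn]
      apply Set.ncard_lt_ncard _ (Set.toFinite _)
      exact ⟨fun w hw => hw.1, fun h => hbW' (h hb.1)⟩
    obtain ⟨u, huW, huy, hyu, hN⟩ := IH _ hlt W' rfl y ⟨hy, Or.inl rfl⟩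
      ⟨a, ⟨ha.1, Or.inr (Or.inl haF)⟩, ha.2.1, ha.2.2⟩
    have huF : u ∈ F := by
      rcases huW.2 with h | h | ⟨f, hf, h⟩
      · exact absurd h huy
      · exact h
      · exact hFc f hf u ⟨huW.1, huy, hyu⟩ h
    have hxF : x ∉ F := hax
    refine ⟨u, huW.1, ?_, ?_, ?_⟩
    · rintro rfl
      exact hxF huF
    · intro h
      by_cases hyx : y = x
      · subst hyx
        exact hyu h
      · exact hxF (hFc u huF x ⟨hx, fun e => hyx e.symm, fun h => hxy h.symm⟩ h.symm)
    · intro p hp q hq r hr s hs up uq ur us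
      exact hN p ⟨hp, Or.inr (Or.inr ⟨u, huF, up⟩)⟩ q ⟨hq, Or.inr (Or.inr ⟨u, huF, uq⟩)⟩
        r ⟨hr, Or.inr (Or.inr ⟨u, huF, ur⟩)⟩ s ⟨hs, Or.inr (Or.inr ⟨u, huF, us⟩)⟩ up uq ur us

lemma exists_noFour [Finite V] [Nonempty V] (hG : InC G) : ∃ v, NoFour G Set.univ v := by
  by_cases h : ∃ x u : V, u ≠ x ∧ ¬ G.Adj x u
  · obtain ⟨x, u, h1, h2⟩ := h
    obtain ⟨v, -, -, -, hv⟩ := main_aux hG _ Set.univ rfl x (Set.mem_univ _)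
      ⟨u, Set.mem_univ _, h1, h2⟩
    exact ⟨v, hv⟩
  · obtain ⟨v⟩ := ‹Nonempty V›
    refine ⟨v, ?_⟩
    intro a _ b _ c _ d _ _ _ _ _ ab _ _ _ _ _ nab
    exact absurd ⟨b, a, ab, fun h' => nab h'.symm⟩ h

lemma three_cliques (hG : InC G) {v : V} (hv : NoFour G Set.univ v) :
    ∃ K₁ K₂ K₃ : Set V, G.IsClique K₁ ∧ G.IsClique K₂ ∧ G.IsClique K₃ ∧
      G.neighborSet v = K₁ ∪ K₂ ∪ K₃ := by
  have hK : ∀ a, G.Adj v a → G.IsClique {u | G.Adj v u ∧ (u = a ∨ G.Adj a u)} := by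
    intro a ha u hu w hw huw
    obtain ⟨hvu, hu⟩ := hu
    obtain ⟨hvw, hw⟩ := hw
    rcases hu with rfl | hu
    · rcases hw with rfl | hw
      · exact absurd rfl huw
      · exact hw
    · rcases hw with rfl | hw
      · exact hu.symm
      · by_contra h
        exact no_diamond hG ha hvu.symm hu.symm hvw.symm hw.symm h huw
  have h0 : G.IsClique (∅ : Set V) := by simp
  by_cases h1 : ∃ a, G.Adj v a
  swap
  · refine ⟨∅, ∅, ∅, h0, h0, h0, ?_⟩
    ext u
    simp only [mem_neighborSet, Set.mem_union, Set.mem_empty_iff_false, or_false]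
    exact ⟨fun h => h1 ⟨u, h⟩, fun h => h.elim⟩
  obtain ⟨a, ha⟩ := h1
  by_cases h2 : ∃ b, G.Adj v b ∧ b ≠ a ∧ ¬ G.Adj a b
  swap
  · refine ⟨_, ∅, ∅, hK a ha, h0, h0, ?_⟩
    ext u
    simp only [mem_neighborSet, Set.mem_union, Set.mem_empty_iff_false, or_false, Set.mem_setOf_eq]
    grind
  obtain ⟨b, hb, hba, hnab⟩ := h2
  by_cases h3 : ∃ c, G.Adj v c ∧ c ≠ a ∧ ¬ G.Adj a c ∧ c ≠ b ∧ ¬ G.Adj b c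
  swap
  · refine ⟨_, _, ∅, hK a ha, hK b hb, h0, ?_⟩
    ext u
    simp only [mem_neighborSet, Set.mem_union, Set.mem_empty_iff_false, or_false, Set.mem_setOf_eq]
    grind
  obtain ⟨c, hc, hca, hnac, hcb, hnbc⟩ := h3
  refine ⟨_, _, _, hK a ha, hK b hb, hK c hc, ?_⟩
  ext u
  have := hv a trivial b trivial c trivial u trivial ha hb hc
  simp only [mem_neighborSet, Set.mem_union, Set.mem_setOf_eq]
  constructor
  · intro hu
    by_contra h
    grind
  · grind

end Main

theorem statement16 {V : Type} [Fintype V] [Nonempty V] (G : SimpleGraph V)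
    (h : InC G) :
    ∃ v : V, ∃ K₁ K₂ K₃ : Set V, G.IsClique K₁ ∧ G.IsClique K₂ ∧ G.IsClique K₃ ∧
      G.neighborSet v = K₁ ∪ K₂ ∪ K₃ := by
  obtain ⟨v, hv⟩ := exists_noFour h
  exact ⟨v, three_cliques h hv⟩

end Paper
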